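/- arXiv:1910.13853 — 2 statements merged into one kernel-verified Lean document; each statement's English description precedes it below -/
import Mathlib

section
/- Level-2 phylogenetic networks on a leaf set X with |X| ≤ 3 are reconstructible from their shortest distances: if N and N' are level-2 networks on the same leaf set X with |X| ≤ 3 and d_m^{N}(x,y) = d_m^{N'}(x,y) for all leaves x, y ∈ X, then N and N' are isomorphic by an isomorphism fixing the leaf labels. -/
open SimpleGraph

/-- A labelled graph: the raw data of a phylogenetic network on a label set `X`:
a finite vertex type, a simple graph on it, and a labelling map from `X` to vertices. -/
structure LabGraph (X : Type) where
  V : Type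
  [fV : Fintype V]
  G : SimpleGraph V
  leaf : X → V

attribute [instance] LabGraph.fV

namespace LabGraph

variable {X : Type} [Fintype X] [DecidableEq X]

/-- The shortest distance `d_m(x,y)` between the leaves labelled `x` and `y`. -/
noncomputable def dm (N : LabGraph X) (x y : X) : ℕ :=
  N.G.dist (N.leaf x) (N.leaf y)

/-- The multiset `d(x,y)` of the lengths of all paths between the leaves `x` and `y`. -/
noncomputable def dms (N : LabGraph X) (x y : X) : Multiset ℕ := by
  classical
  exact (Finset.univ : Finset (N.G.Path (N.leaf x) (N.leaf y))).val.map fun p => p.1.length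

/-- The degree of a vertex. -/
noncomputable def degOf (N : LabGraph X) (v : N.V) : ℕ := (N.G.neighborSet v).ncard

/-- `N` is an (unweighted unrooted binary) phylogenetic network on `X`:
it is connected, the labelling is injective, and either it is the singleton graph
(when `|X| = 1`), or every leaf-labelled vertex has degree 1 and every other
vertex has degree 3 (so the degree-1 vertices are exactly the labelled leaves). -/
def IsNetwork (N : LabGraph X) : Prop :=
  N.G.Connected ∧ Function.Injective N.leaf ∧
    ((Fintype.card X = 1 ∧ Fintype.card N.V = 1) ∨
      ((∀ x : X, N.degOf (N.leaf x) = 1) ∧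
        ∀ v : N.V, v ∉ Set.range N.leaf → N.degOf v = 3))

/-- Two labelled graphs on `X` are isomorphic by a graph isomorphism fixing the leaf labels. -/
def IsomLabelled (N M : LabGraph X) : Prop :=
  ∃ φ : N.G ≃g M.G, ∀ x : X, φ (N.leaf x) = M.leaf x

/-- A subgraph is 2-connected (with at least three vertices): it is connected and
remains connected after deleting any one of its vertices. -/
def TwoConnSub (N : LabGraph X) (H : N.G.Subgraph) : Prop :=
  3 ≤ H.verts.ncard ∧ H.coe.Connected ∧
    ∀ v ∈ H.verts, (H.deleteVerts {v}).coe.Connected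

/-- A blob: a maximal 2-connected subgraph with at least three vertices. -/
def IsBlob (N : LabGraph X) (H : N.G.Subgraph) : Prop :=
  N.TwoConnSub H ∧ ∀ H' : N.G.Subgraph, N.TwoConnSub H' → H ≤ H' → H' = H

/-- Exactly `r` edges must be deleted from the (connected) subgraph `H` to obtain a
tree: `|E(H)| - |V(H)| + 1 = r`.  A level-1 blob has rank 1, a level-2 blob rank 2. -/
def BlobRank (N : LabGraph X) (H : N.G.Subgraph) (r : ℕ) : Prop :=
  H.edgeSet.ncard + 1 = H.verts.ncard + r

/-- A network is level-`k` if at most `k` edges must be deleted from every blob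
to obtain a tree. -/
def IsLevel (N : LabGraph X) (k : ℕ) : Prop :=
  ∀ H : N.G.Subgraph, N.IsBlob H → H.edgeSet.ncard + 1 ≤ H.verts.ncard + k

/-- A cut-edge: an edge whose deletion disconnects the graph. -/
def IsCutEdge (N : LabGraph X) (e : Sym2 N.V) : Prop :=
  e ∈ N.G.edgeSet ∧ ¬ (N.G.deleteEdges {e}).Connected

/-- A trivial (cut-)edge: one incident to a leaf. -/
def TrivialEdge (N : LabGraph X) (e : Sym2 N.V) : Prop :=
  ∃ x : X, N.leaf x ∈ e

/-- An edge is incident to a blob if one of its endpoints is a vertex of the blob. -/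
def EdgeIncBlob (N : LabGraph X) (e : Sym2 N.V) (H : N.G.Subgraph) : Prop :=
  ∃ v ∈ H.verts, v ∈ e

/-- A pendant blob: a blob with exactly one incident non-trivial cut-edge. -/
def IsPendantBlob (N : LabGraph X) (H : N.G.Subgraph) : Prop :=
  N.IsBlob H ∧
    ∃! e : Sym2 N.V, N.IsCutEdge e ∧ ¬ N.TrivialEdge e ∧ N.EdgeIncBlob e H

/-- A leaf is contained in a blob if its neighbour is a vertex of the blob. -/
def LeafInBlob (N : LabGraph X) (x : X) (H : N.G.Subgraph) : Prop :=
  ∃ v : N.V, N.G.Adj (N.leaf x) v ∧ v ∈ H.verts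

/-- `N` has at least two blobs. -/
def TwoBlobs (N : LabGraph X) : Prop :=
  ∃ H₁ H₂ : N.G.Subgraph, N.IsBlob H₁ ∧ N.IsBlob H₂ ∧ H₁ ≠ H₂

/-- Every leaf of `N` is contained in a blob. -/
def AllLeavesInBlobs (N : LabGraph X) : Prop :=
  ∀ x : X, ∃ H : N.G.Subgraph, N.IsBlob H ∧ N.LeafInBlob x H

/-- A chain: a `k`-tuple of leaves with consecutive shortest distances equal to 3. -/
def IsChainT (N : LabGraph X) (k : ℕ) (a : Fin k → X) : Prop :=
  ∀ (i : ℕ) (h : i + 1 < k),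
    N.dm (a ⟨i, Nat.lt_of_succ_lt h⟩) (a ⟨i + 1, h⟩) = 3

/-- A maximal chain: a chain whose leaf set is not properly contained in the leaf
set of another chain. -/
def IsMaxChainT (N : LabGraph X) (k : ℕ) (a : Fin k → X) : Prop :=
  N.IsChainT k a ∧ ∀ (l : ℕ) (b : Fin l → X), N.IsChainT l b →
    Set.range a ⊆ Set.range b → Set.range a = Set.range b

/-- The chain `a` is contained in the blob `H`: the edges between the neighbours of
consecutive chain leaves are edges of `H`. -/
def ChainInBlob (N : LabGraph X) (k : ℕ) (a : Fin k → X) (H : N.G.Subgraph) : Prop :=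
  ∀ (i : ℕ) (h : i + 1 < k) (p q : N.V),
    N.G.Adj (N.leaf (a ⟨i, Nat.lt_of_succ_lt h⟩)) p →
    N.G.Adj (N.leaf (a ⟨i + 1, h⟩)) q → H.Adj p q

/-- The multiset of natural numbers `A`, viewed in `ℤ`. -/
def toZ (A : Multiset ℕ) : Multiset ℤ := A.map (fun t => (t : ℤ))

/-- `A - n`: subtract `n` from every element of the multiset `A` (in `ℤ`). -/
def zsub (A : Multiset ℕ) (n : ℤ) : Multiset ℤ := A.map (fun t => (t : ℤ) - n)

section Aux

open Classical

/-- Cut version of connectedness of the induced subgraph on `W`. -/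
def CC {V : Type} (G : SimpleGraph V) (W : Finset V) : Prop :=
  W.Nonempty ∧ ∀ A ⊆ W, A.Nonempty → A ≠ W → ∃ a ∈ A, ∃ b ∈ W, b ∉ A ∧ G.Adj a b

/-- Degree of `v` into `W`. -/
noncomputable def dg {V : Type} (G : SimpleGraph V) (W : Finset V) (v : V) : ℕ :=
  (W.filter (fun w => G.Adj v w)).card

/-- Twice the number of edges inside `W`. -/
noncomputable def ee {V : Type} (G : SimpleGraph V) (W : Finset V) : ℕ := ∑ v ∈ W, dg G W v

/-- Proper networks with the hereditary form of level 2. -/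
structure Net2 {X : Type} (N : LabGraph X) : Prop where
  conn : N.G.Connected
  inj : Function.Injective N.leaf
  deg1 : ∀ x, dg N.G Finset.univ (N.leaf x) = 1
  deg3 : ∀ v, v ∉ Set.range N.leaf → dg N.G Finset.univ v = 3
  lev : ∀ W : Finset N.V, 3 ≤ W.card → CC N.G W → (∀ v ∈ W, CC N.G (W.erase v)) →
    ee N.G W ≤ 2 * W.card + 2

theorem conn_cut {V : Type} {G : SimpleGraph V} (h : G.Connected) (A : Set V)
    (hA : A.Nonempty) (hA' : A ≠ Set.univ) : ∃ a ∈ A, ∃ b, b ∉ A ∧ G.Adj a b := by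
  by_contra hcon
  push Not at hcon
  obtain ⟨a, ha⟩ := hA
  apply hA'
  ext b
  simp only [Set.mem_univ, iff_true]
  obtain ⟨p⟩ := h.preconnected a b
  induction p with
  | nil => exact ha
  | cons hadj p ih =>
    apply ih
    by_contra hh
    exact hcon _ ha _ hh hadj

theorem cut_conn {V : Type} {G : SimpleGraph V} [Nonempty V]
    (h : ∀ A : Set V, A.Nonempty → A ≠ Set.univ → ∃ a ∈ A, ∃ b, b ∉ A ∧ G.Adj a b) :
    G.Connected := by
  refine (SimpleGraph.connected_iff _).2 ⟨fun a b => ?_, inferInstance⟩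
  by_contra hab
  obtain ⟨c, hc, d, hd, hcd⟩ := h {c | G.Reachable a c} ⟨a, SimpleGraph.Reachable.refl _⟩
    (fun hu => hab (by have : b ∈ {c | G.Reachable a c} := hu ▸ Set.mem_univ b
                       exact this))
  exact hd (SimpleGraph.Reachable.trans hc hcd.reachable)

theorem sub_CC {V : Type} [Fintype V] {G : SimpleGraph V} (H : G.Subgraph) (W : Finset V)
    (hW : (W : Set V) = H.verts) : H.coe.Connected ↔ CC H.spanningCoe W := by
  have hmem : ∀ v, v ∈ W ↔ v ∈ H.verts := fun v => by rw [← hW]; simp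
  constructor
  · intro h
    obtain ⟨v⟩ := h.nonempty
    refine ⟨⟨v.1, (hmem _).2 v.2⟩, fun A hAW hA hne => ?_⟩
    obtain ⟨a, ha, b, hb, hab⟩ := conn_cut h {v : H.verts | v.1 ∈ A}
      (by obtain ⟨a, ha⟩ := hA
          exact ⟨⟨a, (hmem _).1 (hAW ha)⟩, ha⟩)
      (fun hu => hne (by
        apply Finset.Subset.antisymm hAW
        intro w hw
        have : (⟨w, (hmem _).1 hw⟩ : H.verts) ∈ {v : H.verts | v.1 ∈ A} := hu ▸ Set.mem_univ _
        exact this))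
    exact ⟨a.1, ha, b.1, (hmem _).2 b.2, hb, hab⟩
  · rintro ⟨⟨w, hw⟩, h⟩
    have : Nonempty H.verts := ⟨⟨w, (hmem _).1 hw⟩⟩
    refine cut_conn fun A hA hne => ?_
    obtain ⟨a, ha, b, hb, hba, hab⟩ := h (W.filter (fun v => ∃ hv : v ∈ H.verts, (⟨v, hv⟩ : H.verts) ∈ A))
      (Finset.filter_subset _ _)
      (by obtain ⟨a, ha⟩ := hA
          exact ⟨a.1, by simp [hmem, ha]⟩)
      (fun hu => hne (by
        ext v
        simp only [Set.mem_univ, iff_true]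
        have : v.1 ∈ W := (hmem _).2 v.2
        rw [← hu] at this
        simp at this
        exact this.2))
    have hbv := (hmem _).1 hb
    simp only [Finset.mem_filter] at ha hba
    obtain ⟨haW, hav, haA⟩ := ha
    refine ⟨⟨a, hav⟩, haA, ⟨b, hbv⟩, fun hbA => hba ⟨hb, hbv, hbA⟩, hab⟩

theorem dg_insert_ge {V : Type} (G : SimpleGraph V) (W : Finset V) (b v : V) :
    dg G W v ≤ dg G (insert b W) v := by
  apply Finset.card_le_card
  apply Finset.filter_subset_filter
  exact Finset.subset_insert _ _

theorem rank_mono {V : Type} (G : SimpleGraph V) (W' : Finset V) (h : CC G W') :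
    ∀ (n : ℕ) (W : Finset V), (W' \ W).card = n → W ⊆ W' → W.Nonempty →
      ee G W + 2 * W'.card ≤ ee G W' + 2 * W.card := by
  intro n
  induction n with
  | zero =>
    intro W hn hW _
    rw [Finset.card_eq_zero, Finset.sdiff_eq_empty_iff_subset] at hn
    rw [Finset.Subset.antisymm hW hn]
  | succ n ih =>
    intro W hn hW hne
    have hWW : W ≠ W' := by
      rintro rfl
      simp at hn
    obtain ⟨a, ha, b, hb, hbW, hab⟩ := h.2 W hW hne hWW
    have h1 := ih (insert b W) (by
      rw [Finset.sdiff_insert, Finset.card_erase_of_mem (by simp [hb, hbW]), hn]; rfl)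
      (Finset.insert_subset hb hW) (Finset.insert_nonempty _ _)
    rw [Finset.card_insert_of_notMem hbW] at h1
    have h2 : ee G W + 2 ≤ ee G (insert b W) := by
      unfold ee
      rw [Finset.sum_insert hbW]
      have h3 : 1 ≤ dg G (insert b W) b := by
        apply Finset.card_pos.2
        exact ⟨a, by simp [ha, hab.symm]⟩
      have h4 : ∑ v ∈ W, dg G W v < ∑ v ∈ W, dg G (insert b W) v := by
        apply Finset.sum_lt_sum (fun v _ => dg_insert_ge G W b v)
        refine ⟨a, ha, ?_⟩
        apply Finset.card_lt_card
        rw [Finset.ssubset_iff_of_subset (Finset.filter_subset_filter _ (Finset.subset_insert _ _))]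
        exact ⟨b, by simp [hab], by simp [hbW]⟩
      omega
    omega

theorem dg_eq_degOf {X : Type} [Fintype X] [DecidableEq X] (N : LabGraph X) (v : N.V) : dg N.G Finset.univ v = N.degOf v := by
  unfold dg degOf
  rw [Set.ncard_eq_toFinset_card']
  congr 1
  ext w
  simp

theorem lev_of_isLevel {X : Type} [Fintype X] [DecidableEq X] (N : LabGraph X) (hlev : N.IsLevel 2) (W : Finset N.V)
    (h3 : 3 ≤ W.card) (hc : CC N.G W) (hv : ∀ v ∈ W, CC N.G (W.erase v)) :
    ee N.G W ≤ 2 * W.card + 2 := by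
  set H0 : N.G.Subgraph := (⊤ : N.G.Subgraph).induce (W : Set N.V) with hH0
  have hCCmono : ∀ (G G' : SimpleGraph N.V) (A : Finset N.V),
      (∀ a ∈ A, ∀ b ∈ A, G.Adj a b → G'.Adj a b) → CC G A → CC G' A := by
    intro G G' A h hA
    refine ⟨hA.1, fun B hB hBn hBA => ?_⟩
    obtain ⟨a, ha, b, hb, hbB, hab⟩ := hA.2 B hB hBn hBA
    exact ⟨a, ha, b, hb, hbB, h a (hB ha) b hb hab⟩
  have hT0 : N.TwoConnSub H0 := by
    refine ⟨?_, ?_, ?_⟩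
    · simpa [hH0] using h3
    · rw [sub_CC H0 W (by simp [hH0])]
      refine hCCmono _ _ _ ?_ hc
      intro a ha b hb hab
      simp [hH0, ha, hb, hab]
    · intro v hvW
      rw [sub_CC _ (W.erase v) (by simp [hH0])]
      refine hCCmono _ _ _ ?_ (hv v (by simpa [hH0] using hvW))
      intro a ha b hb hab
      simp only [Finset.mem_erase] at ha hb
      simp [hH0, ha, hb, hab]
  obtain ⟨H, hle, hmax⟩ := Set.Finite.exists_le_maximal
    (Set.toFinite {H : N.G.Subgraph | N.TwoConnSub H}) (a := H0) hT0
  have hblob : N.IsBlob H := by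
    refine ⟨hmax.1, fun H' hH' hle' => ?_⟩
    exact le_antisymm (hmax.2 hH' hle') hle'
  have hE := hlev H hblob
  set W' : Finset N.V := H.verts.toFinset with hW'
  have hC := (sub_CC H W' (by simp [hW'])).1 hmax.1.2.1
  have hWW : W ⊆ W' := by
    intro w hw
    have : w ∈ H0.verts := by simpa [hH0] using hw
    simpa [hW'] using hle.1 this
  have hr := rank_mono H.spanningCoe W' hC _ W rfl hWW hc.1
  have he0 : ee H.spanningCoe W = ee N.G W := by
    unfold ee
    apply Finset.sum_congr rfl
    intro v hvW
    unfold dg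
    congr 1
    apply Finset.filter_congr
    intro w hw
    constructor
    · intro h
      exact H.adj_sub h
    · intro h
      have : H0.Adj v w := by simp [hH0, hvW, hw, h]
      exact hle.2 this
  have he1 : ee H.spanningCoe W' = 2 * H.edgeSet.ncard := by
    have h1 := H.spanningCoe.sum_degrees_eq_twice_card_edges
    have h2 : H.edgeSet.ncard = H.spanningCoe.edgeFinset.card := by
      rw [Set.ncard_eq_toFinset_card']
      congr 1
      ext e
      simp
    rw [h2, ← h1]
    unfold ee
    rw [← Finset.sum_subset (Finset.subset_univ W')]
    · apply Finset.sum_congr rfl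
      intro v hv
      unfold dg
      rw [← SimpleGraph.card_neighborFinset_eq_degree]
      congr 1
      ext w
      simp only [Finset.mem_filter, SimpleGraph.mem_neighborFinset]
      constructor
      · exact fun h => h.2
      · intro h
        refine ⟨?_, h⟩
        simp [hW']
        exact H.edge_vert (H.adj_symm h)
    · intro v _ hv
      rw [SimpleGraph.degree_eq_zero_iff_notMem_support]
      rintro ⟨w, hw⟩
      apply hv
      simp [hW']
      exact H.edge_vert hw
  have hcard : W'.card = H.verts.ncard := by
    rw [Set.ncard_eq_toFinset_card']
  omega

theorem net2_of {X : Type} [Fintype X] [DecidableEq X] (N : LabGraph X) (hN : N.IsNetwork) (hlev : N.IsLevel 2) :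
    (Fintype.card X = 1 ∧ Fintype.card N.V = 1) ∨ Net2 N := by
  obtain ⟨hc, hi, h | h⟩ := hN
  · exact Or.inl h
  · refine Or.inr ⟨hc, hi, ?_, ?_, lev_of_isLevel N hlev⟩
    · intro x
      rw [dg_eq_degOf]
      exact h.1 x
    · intro v hv
      rw [dg_eq_degOf]
      exact h.2 v hv

/-- A leaf sitting on a pendant diamond. -/
def Dia {X : Type} (N : LabGraph X) (x : X) : Prop :=
  ∃ p c d u, N.G.Adj (N.leaf x) p ∧ N.G.Adj p c ∧ N.G.Adj p d ∧ N.G.Adj c d ∧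
    N.G.Adj c u ∧ N.G.Adj d u ∧ p ≠ u

/-- `S` has exactly one leaving edge, from `a ∈ S` to `b ∉ S`. -/
def Pend {V : Type} (G : SimpleGraph V) (S : Finset V) (a b : V) : Prop :=
  a ∈ S ∧ b ∉ S ∧ G.Adj a b ∧ ∀ c ∈ S, ∀ d, d ∉ S → G.Adj c d → c = a ∧ d = b

/-- `W` is 2-edge-connected (cut version). -/
def TEC {V : Type} (G : SimpleGraph V) (W : Finset V) : Prop :=
  ∀ A ⊆ W, A.Nonempty → A ≠ W → ∃ a ∈ A, ∃ b ∈ W, ∃ a' ∈ A, ∃ b' ∈ W,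
    b ∉ A ∧ b' ∉ A ∧ G.Adj a b ∧ G.Adj a' b' ∧ ¬ (a = a' ∧ b = b')

theorem Net2.leaf_nbr {X : Type} {N : LabGraph X} (h : Net2 N) (x : X) :
    ∃ p, N.G.Adj (N.leaf x) p ∧ ∀ q, N.G.Adj (N.leaf x) q → q = p := by
  obtain ⟨p, hp⟩ := Finset.card_eq_one.1 (h.deg1 x)
  refine ⟨p, ?_, fun q hq => ?_⟩
  · have : p ∈ Finset.univ.filter (fun w => N.G.Adj (N.leaf x) w) := by rw [hp]; simp
    simpa using this
  · have : q ∈ Finset.univ.filter (fun w => N.G.Adj (N.leaf x) w) := by simpa using hq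
    rw [hp] at this
    simpa using this

theorem Net2.leaf_uniq {X : Type} {N : LabGraph X} (h : Net2 N) (x : X) {p q : N.V}
    (hp : N.G.Adj (N.leaf x) p) (hq : N.G.Adj (N.leaf x) q) : p = q := by
  obtain ⟨r, _, hr⟩ := h.leaf_nbr x
  rw [hr p hp, hr q hq]

theorem Net2.le3 {X : Type} {N : LabGraph X} (h : Net2 N) (v : N.V) :
    dg N.G Finset.univ v ≤ 3 := by
  by_cases hv : v ∈ Set.range N.leaf
  · obtain ⟨x, rfl⟩ := hv
    rw [h.deg1 x]; omega
  · rw [h.deg3 v hv]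

theorem dg_split {V : Type} [Fintype V] (G : SimpleGraph V) (W : Finset V) (v : V) :
    dg G W v + dg G Wᶜ v = dg G Finset.univ v := by
  unfold dg
  rw [← Finset.card_union_of_disjoint]
  · rw [← Finset.filter_union, Finset.union_compl]
  · apply Finset.disjoint_filter_filter
    exact disjoint_compl_right

theorem dg_mono {V : Type} (G : SimpleGraph V) {W W' : Finset V} (h : W ⊆ W') (v : V) :
    dg G W v ≤ dg G W' v :=
  Finset.card_le_card (Finset.filter_subset_filter _ h)

theorem dg_lt {V : Type} (G : SimpleGraph V) {W : Finset V} {v : V} (hv : v ∈ W) :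
    dg G W v + 1 ≤ W.card := by
  have : W.filter (fun w => G.Adj v w) ⊆ W.erase v := by
    intro w hw
    simp only [Finset.mem_filter] at hw
    exact Finset.mem_erase.2 ⟨hw.2.ne', hw.1⟩
  have h := Finset.card_le_card this
  rw [Finset.card_erase_of_mem hv] at h
  have := Finset.card_pos.2 ⟨v, hv⟩
  unfold dg
  omega

theorem dg_full {V : Type} (G : SimpleGraph V) {W : Finset V} {v : V} (hv : v ∈ W)
    (h : W.card ≤ dg G W v + 1) : ∀ w ∈ W, w ≠ v → G.Adj v w := by
  have : W.filter (fun w => G.Adj v w) ⊆ W.erase v := by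
    intro w hw
    simp only [Finset.mem_filter] at hw
    exact Finset.mem_erase.2 ⟨hw.2.ne', hw.1⟩
  have h2 := Finset.eq_of_subset_of_card_le this (by
    rw [Finset.card_erase_of_mem hv]
    unfold dg at h
    omega)
  intro w hw hwv
  have : w ∈ W.erase v := Finset.mem_erase.2 ⟨hwv, hw⟩
  rw [← h2] at this
  exact (Finset.mem_filter.1 this).2

theorem dg_pos {V : Type} (G : SimpleGraph V) {W : Finset V} {v w : V} (hw : w ∈ W)
    (h : G.Adj v w) : 1 ≤ dg G W v :=
  Finset.card_pos.2 ⟨w, by simp [hw, h]⟩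

theorem dg_two {V : Type} (G : SimpleGraph V) {W : Finset V} {v w w' : V} (hw : w ∈ W)
    (h : G.Adj v w) (hw' : w' ∈ W) (h' : G.Adj v w') (hne : w ≠ w') : 2 ≤ dg G W v := by
  rw [← Finset.card_pair hne]
  apply Finset.card_le_card
  intro z hz
  simp only [Finset.mem_insert, Finset.mem_singleton] at hz
  rcases hz with rfl | rfl <;> simp [*]

theorem dg_dc {V : Type} (G : SimpleGraph V) (A B : Finset V) :
    ∑ v ∈ A, dg G B v = ∑ w ∈ B, dg G A w := by
  have := Finset.sum_card_bipartiteAbove_eq_sum_card_bipartiteBelow (s := A) (t := B)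
    (fun v w => G.Adj v w)
  unfold dg
  rw [show (∑ v ∈ A, (B.filter (fun w => G.Adj v w)).card) = _ from this]
  apply Finset.sum_congr rfl
  intro w _
  congr 1
  unfold Finset.bipartiteBelow
  apply Finset.filter_congr
  intro v _
  exact G.adj_comm v w

theorem TEC.twoconn {V : Type} [Fintype V] {G : SimpleGraph V} {W : Finset V} (h : TEC G W)
    (h2 : 2 ≤ W.card) (hd : ∀ v ∈ W, dg G Finset.univ v ≤ 3) :
    CC G W ∧ ∀ v ∈ W, CC G (W.erase v) := by
  refine ⟨⟨Finset.card_pos.1 (by omega), fun A hA hAn hne => ?_⟩, fun v hv => ⟨?_, fun A hA hAn hne => ?_⟩⟩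
  · obtain ⟨a, ha, b, hb, _, _, _, _, hbA, _, hab, _⟩ := h A hA hAn hne
    exact ⟨a, ha, b, hb, hbA, hab⟩
  · apply Finset.card_pos.1
    rw [Finset.card_erase_of_mem hv]; omega
  · by_contra hcon
    push Not at hcon
    have hAW : A ⊆ W := hA.trans (Finset.erase_subset _ _)
    have hvA : v ∉ A := fun hh => by simpa using hA hh
    obtain ⟨a, ha, b, hb, a', ha', b', hb', hbA, hbA', hab, hab', hn⟩ := h A hAW hAn
      (by rintro rfl; exact hvA hv)
    have key : ∀ c ∈ A, ∀ d ∈ W, d ∉ A → G.Adj c d → d = v := by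
      intro c hc d hd hdA hcd
      by_contra hdv
      exact hcon c hc d (Finset.mem_erase.2 ⟨hdv, hd⟩) hdA hcd
    obtain rfl := key a ha b hb hbA hab
    obtain rfl := key a' ha' b' hb' hbA' hab'
    obtain ⟨c, hc, d, hdd, c', hc', d', hd', hdB, hdB', hcd, hcd', hn'⟩ :=
      h ((W.erase b') \ A) (Finset.sdiff_subset.trans (Finset.erase_subset _ _))
      (by
        rw [Finset.sdiff_nonempty]
        intro hs
        exact hne (Finset.Subset.antisymm hA hs))
      (by
        intro he
        rw [← he] at hv
        simp at hv)
    have key2 : ∀ c ∈ (W.erase b') \ A, ∀ d ∈ W, d ∉ (W.erase b') \ A → G.Adj c d → d = b' := by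
      intro c hc d hd hdA hcd
      by_contra hdv
      simp only [Finset.mem_sdiff, Finset.mem_erase] at hc hdA
      have : d ∈ A := by
        by_contra hh
        exact hdA ⟨⟨hdv, hd⟩, hh⟩
      exact hcon d this c (Finset.mem_erase.2 hc.1) hc.2 hcd.symm
    obtain rfl := key2 c hc d hdd hdB hcd
    obtain rfl := key2 c' hc' d' hd' hdB' hcd'
    have haa : a ≠ a' := fun e => hn ⟨e, rfl⟩
    have hcc : c ≠ c' := fun e => hn' ⟨e, rfl⟩
    simp only [Finset.mem_sdiff] at hc hc'
    have hA2 : 2 ≤ dg G A d' := dg_two G ha hab.symm ha' hab'.symm haa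
    have hB2 : 2 ≤ dg G Aᶜ d' := dg_two G (by simp [hc.2]) hcd.symm (by simp [hc'.2]) hcd'.symm hcc
    have := dg_split G A d'
    have := hd d' hv
    omega

theorem Net2.count {X : Type} {N : LabGraph X} (h : Net2 N) (W : Finset N.V)
    (hW : ∀ v ∈ W, v ∉ Set.range N.leaf) (ht : TEC N.G W) (h3 : 3 ≤ W.card) :
    W.card ≤ ∑ v ∈ W, dg N.G Wᶜ v + 2 := by
  obtain ⟨h1, h2⟩ := ht.twoconn (by omega) (fun v _ => h.le3 v)
  have h4 := h.lev W h3 h1 h2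
  have h5 : ∑ v ∈ W, (dg N.G W v + dg N.G Wᶜ v) = ∑ v ∈ W, 3 := by
    apply Finset.sum_congr rfl
    intro v hv
    rw [dg_split, h.deg3 v (hW v hv)]
  rw [Finset.sum_add_distrib] at h5
  simp at h5
  unfold ee at h4
  omega

theorem Net2.out_lb {X : Type} {N : LabGraph X} (h : Net2 N) (W : Finset N.V)
    (hW : ∀ v ∈ W, v ∉ Set.range N.leaf) :
    W.card * (4 - W.card) ≤ ∑ v ∈ W, dg N.G Wᶜ v := by
  rw [← smul_eq_mul]
  apply Finset.card_nsmul_le_sum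
  intro v hv
  have h1 := dg_lt N.G hv
  have h2 := dg_split N.G W v
  rw [h.deg3 v (hW v hv)] at h2
  omega

theorem pendant_aux {X : Type} [Fintype X] {N : LabGraph X} (h : Net2 N) :
    ∀ (n : ℕ) (S : Finset N.V) (a b : N.V), S.card = n → Pend N.G S a b →
      (Finset.univ.filter (fun x => N.leaf x ∈ S)).card ≤ 1 →
      ∃ x, N.leaf x ∈ S ∧ (S = {N.leaf x} ∨ Dia N x) := by
  intro n
  induction n using Nat.strong_induction_on with
  | _ n ih =>
  intro S a b hn hP hl
  obtain ⟨haS, hbS, hab, hcr⟩ := hP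
  by_cases hal : a ∈ Set.range N.leaf
  · obtain ⟨x, rfl⟩ := hal
    refine ⟨x, haS, Or.inl ?_⟩
    by_contra hne
    obtain ⟨c, hc, d, hd, hcd⟩ := conn_cut h.conn ((S.erase (N.leaf x) : Finset N.V) : Set N.V)
      (by
        obtain ⟨c, hc, hcx⟩ := (Finset.nontrivial_iff_ne_singleton haS).2 hne |>.exists_ne (N.leaf x)
        exact ⟨c, by simp [hc, hcx]⟩)
      (by
        intro hu
        have : N.leaf x ∈ ((S.erase (N.leaf x) : Finset N.V) : Set N.V) := hu ▸ Set.mem_univ _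
        simp at this)
    simp only [Finset.coe_erase, Set.mem_sdiff, Finset.mem_coe, Set.mem_singleton_iff, not_and, not_not] at hc hd
    by_cases hdS : d ∈ S
    · obtain rfl := hd hdS
      have := h.leaf_uniq x hab hcd.symm
      subst this
      exact hbS hc.1
    · exact hc.2 (hcr c hc.1 d hdS hcd).1
  set W := S.filter (fun v => v ∉ Set.range N.leaf) with hWdef
  have hWS : W ⊆ S := Finset.filter_subset _ _
  have hWl : ∀ v ∈ W, v ∉ Set.range N.leaf := fun v hv => (Finset.mem_filter.1 hv).2
  have haW : a ∈ W := Finset.mem_filter.2 ⟨haS, hal⟩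
  by_cases hT : TEC N.G W
  swap
  · -- a proper smaller pendant set
    have hA : ∃ A ⊆ W, A.Nonempty ∧ a ∉ A ∧ ∀ c ∈ A, ∀ d ∈ W, ∀ c' ∈ A, ∀ d' ∈ W,
        d ∉ A → d' ∉ A → N.G.Adj c d → N.G.Adj c' d' → c = c' ∧ d = d' := by
      unfold TEC at hT
      push Not at hT
      obtain ⟨A, hAW, hAn, hAne, hA⟩ := hT
      by_cases haA : a ∈ A
      · refine ⟨W \ A, Finset.sdiff_subset, ?_, by simp [haA], ?_⟩
        · rw [Finset.sdiff_nonempty]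
          intro hs
          exact hAne (Finset.Subset.antisymm hAW hs)
        · intro c hc d hd c' hc' d' hd' hdA hdA' hcd hcd'
          simp only [Finset.mem_sdiff, not_and, not_not] at hc hc' hdA hdA'
          have := hA d (hdA hd) c hc.1 d' (hdA' hd') c' hc'.1 hc.2 hc'.2 hcd.symm hcd'.symm
          exact ⟨this.2, this.1⟩
      · exact ⟨A, hAW, hAn, haA, hA⟩
    obtain ⟨A, hAW, ⟨e, he⟩, haA, hA⟩ := hA
    set T := A ∪ S.filter (fun v => v ∈ Set.range N.leaf ∧ ∃ c ∈ A, N.G.Adj v c) with hTdef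
    have hmT : ∀ v, v ∈ T ↔ v ∈ A ∨ (v ∈ S ∧ v ∈ Set.range N.leaf ∧ ∃ c ∈ A, N.G.Adj v c) := by
      intro v
      rw [hTdef, Finset.mem_union, Finset.mem_filter]
    have hTS : T ⊆ S := by
      intro v hv
      rcases (hmT v).1 hv with h1 | h1
      · exact hWS (hAW h1)
      · exact h1.1
    have haT : a ∉ T := by
      intro hh
      rcases (hmT a).1 hh with h1 | h1
      · exact haA h1
      · exact hal h1.2.1
    have hcross : ∀ c ∈ T, ∀ d, d ∉ T → N.G.Adj c d → c ∈ A ∧ d ∈ W ∧ d ∉ A := by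
      intro c hc d hd hcd
      have hdA : d ∉ A := fun hh => hd ((hmT d).2 (Or.inl hh))
      rcases (hmT c).1 hc with h1 | ⟨h1, ⟨x, rfl⟩, e, heA, hce⟩
      · refine ⟨h1, ?_, hdA⟩
        have hdS : d ∈ S := by
          by_contra hdS
          have := (hcr c (hTS hc) d hdS hcd).1
          subst this
          exact haA h1
        refine Finset.mem_filter.2 ⟨hdS, fun hdl => hd ((hmT d).2 (Or.inr ⟨hdS, hdl, c, h1, hcd.symm⟩))⟩
      · have := h.leaf_uniq x hcd hce
        subst this
        exact absurd heA hdA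
    have heT : e ∈ T := (hmT e).2 (Or.inl he)
    obtain ⟨c, hc, d, hd, hcd⟩ := conn_cut h.conn (T : Set N.V) ⟨e, heT⟩
      (fun hu => haT (by
        have : a ∈ (T : Set N.V) := hu ▸ Set.mem_univ _
        exact this))
    have hc : c ∈ T := hc
    have hd : d ∉ T := hd
    have h1 := hcross c hc d hd hcd
    obtain ⟨x, hx, hx'⟩ := ih T.card (by
        rw [← hn]
        apply Finset.card_lt_card
        exact ⟨hTS, fun hs => haT (hs haS)⟩) T c d rfl
        ⟨hc, hd, hcd, fun c' hc' d' hd' hcd' => by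
          have h2 := hcross c' hc' d' hd' hcd'
          have h3 := hA c h1.1 d h1.2.1 c' h2.1 d' h2.2.1 h1.2.2 h2.2.2 hcd hcd'
          exact ⟨h3.1.symm, h3.2.symm⟩⟩
        (le_trans (Finset.card_le_card (fun x hx => by
          simp only [Finset.mem_filter, Finset.mem_univ, true_and] at hx ⊢
          exact hTS hx)) hl)
    refine ⟨x, hTS hx, Or.inr ?_⟩
    rcases hx' with h2 | h2
    · rw [h2] at heT
      have := Finset.mem_singleton.1 heT
      exact absurd ⟨x, this.symm⟩ (hWl e (hAW he))
    · exact h2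
  -- the two-edge-connected case
  have hout : ∑ v ∈ W, dg N.G Wᶜ v ≤ (Finset.univ.filter (fun x => N.leaf x ∈ S)).card + 1 := by
    rw [dg_dc]
    calc ∑ w ∈ Wᶜ, dg N.G W w ≤ ∑ w ∈ Wᶜ, (if w ∈ insert b ((Finset.univ.filter (fun x => N.leaf x ∈ S)).image N.leaf) then 1 else 0) := by
          apply Finset.sum_le_sum
          intro w hw
          have hwW : w ∉ W := by simpa using hw
          split_ifs with hif
          · rw [Finset.mem_insert] at hif
            rcases hif with rfl | hif
            · refine le_trans (Finset.card_le_card (t := {a}) ?_) (by simp)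
              intro v hv
              rw [Finset.mem_filter] at hv
              exact Finset.mem_singleton.2 (hcr v (hWS hv.1) w hbS hv.2.symm).1
            · obtain ⟨x, _, rfl⟩ := Finset.mem_image.1 hif
              rw [← h.deg1 x]
              exact dg_mono _ (Finset.subset_univ _) _
          · rw [Nat.le_zero]
            apply Finset.card_eq_zero.2
            rw [Finset.filter_eq_empty_iff]
            intro v hv hadj
            apply hif
            by_cases hwS : w ∈ S
            · have : w ∈ Set.range N.leaf := by
                by_contra hh
                exact hwW (Finset.mem_filter.2 ⟨hwS, hh⟩)
              obtain ⟨x, rfl⟩ := this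
              exact Finset.mem_insert_of_mem (Finset.mem_image.2 ⟨x, by simpa using hwS, rfl⟩)
            · have := (hcr v (hWS hv) w hwS hadj.symm).2
              simp [this]
      _ ≤ (insert b ((Finset.univ.filter (fun x => N.leaf x ∈ S)).image N.leaf)).card := by
          rw [Finset.sum_ite_mem, Finset.sum_const, smul_eq_mul, mul_one]
          exact Finset.card_le_card Finset.inter_subset_right
      _ ≤ _ := by
          refine le_trans (Finset.card_insert_le _ _) ?_
          have := Finset.card_image_le (s := Finset.univ.filter (fun x => N.leaf x ∈ S)) (f := N.leaf)
          omega
  have hlb := h.out_lb W hWl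
  have hpos : 1 ≤ W.card := Finset.card_pos.2 ⟨a, haW⟩
  have hcnt := h.count W hWl hT
  have hW4 : W.card = 4 := by
    have h3 : 3 ≤ W.card := by
      by_contra hh
      have : W.card = 1 ∨ W.card = 2 := by omega
      rcases this with e | e <;> rw [e] at hlb <;> omega
    have := hcnt h3
    by_contra hh
    have : W.card = 3 := by omega
    rw [this] at hlb
    omega
  have hcnt' := hcnt (by omega)
  have hl1 : (Finset.univ.filter (fun x => N.leaf x ∈ S)).card = 1 := by omega
  obtain ⟨x, hx⟩ := Finset.card_eq_one.1 hl1
  have hxS : N.leaf x ∈ S := by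
    have : x ∈ Finset.univ.filter (fun x => N.leaf x ∈ S) := by rw [hx]; simp
    simpa using this
  have hxu : ∀ y, N.leaf y ∈ S → y = x := by
    intro y hy
    have : y ∈ Finset.univ.filter (fun x => N.leaf x ∈ S) := by simpa using hy
    rw [hx] at this
    simpa using this
  refine ⟨x, hxS, Or.inr ?_⟩
  obtain ⟨p, hp, _⟩ := h.leaf_nbr x
  have hpS : p ∈ S := by
    by_contra hh
    exact hal ⟨x, (hcr _ hxS p hh hp).1⟩
  have hpW : p ∈ W := by
    refine Finset.mem_filter.2 ⟨hpS, ?_⟩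
    rintro ⟨y, rfl⟩
    have := hxu y hpS
    subst this
    exact hp.ne rfl
  have hxW : N.leaf x ∈ Wᶜ := by
    rw [Finset.mem_compl]
    exact fun hh => hWl _ hh ⟨x, rfl⟩
  have hbW : b ∈ Wᶜ := by
    rw [Finset.mem_compl]
    exact fun hh => hbS (hWS hh)
  have ha1 : 1 ≤ dg N.G Wᶜ a := dg_pos _ hbW hab
  have hp1 : 1 ≤ dg N.G Wᶜ p := dg_pos _ hxW hp.symm
  have hfull : ∀ v ∈ W, dg N.G Wᶜ v = 0 → ∀ w ∈ W, w ≠ v → N.G.Adj v w := by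
    intro v hv h0
    apply dg_full _ hv
    have := dg_split N.G W v
    rw [h.deg3 v (hWl v hv)] at this
    omega
  have hsum := Finset.add_sum_erase W (fun v => dg N.G Wᶜ v) haW
  by_cases hpa : p = a
  · subst hpa
    exfalso
    have h2 : 2 ≤ dg N.G Wᶜ p := dg_two _ hbW hab hxW hp.symm (by rintro rfl; exact hbS hxS)
    have h0 : ∑ v ∈ W.erase p, dg N.G Wᶜ v = 0 := by omega
    rw [Finset.sum_eq_zero_iff] at h0
    have h3 : W.erase p ⊆ W.filter (fun w => N.G.Adj p w) := by
      intro v hv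
      have hvW := Finset.mem_of_mem_erase hv
      refine Finset.mem_filter.2 ⟨hvW, ?_⟩
      exact (hfull v hvW (h0 v hv) p hpW (Finset.ne_of_mem_erase hv).symm).symm
    have h4 := Finset.card_le_card h3
    rw [Finset.card_erase_of_mem hpW, hW4] at h4
    have := dg_split N.G W p
    rw [h.deg3 p hal] at this
    unfold dg at *
    omega
  · have hpe : p ∈ W.erase a := Finset.mem_erase.2 ⟨hpa, hpW⟩
    have hsum2 := Finset.add_sum_erase (W.erase a) (fun v => dg N.G Wᶜ v) hpe
    have h0 : ∑ v ∈ (W.erase a).erase p, dg N.G Wᶜ v = 0 := by omega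
    rw [Finset.sum_eq_zero_iff] at h0
    have hc2 : ((W.erase a).erase p).card = 2 := by
      rw [Finset.card_erase_of_mem hpe, Finset.card_erase_of_mem haW, hW4]
    obtain ⟨c, d, hcd, hcde⟩ := Finset.card_eq_two.1 hc2
    have hc : c ∈ (W.erase a).erase p := by rw [hcde]; simp
    have hd : d ∈ (W.erase a).erase p := by rw [hcde]; simp
    have fc := hfull c (by simp at hc; tauto) (h0 c hc)
    have fd := hfull d (by simp at hd; tauto) (h0 d hd)
    simp only [Finset.mem_erase] at hc hd
    exact ⟨p, c, d, a, hp, (fc p hpW (Ne.symm hc.1)).symm, (fd p hpW (Ne.symm hd.1)).symm,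
      fc d hd.2.2 (Ne.symm hcd), fc a haW (Ne.symm hc.2.1), fd a haW (Ne.symm hd.2.1), hpa⟩

theorem Net2.pendant {X : Type} [Fintype X] {N : LabGraph X} (h : Net2 N)
    (S : Finset N.V) (a b : N.V) (hP : Pend N.G S a b)
    (hl : (Finset.univ.filter (fun x => N.leaf x ∈ S)).card ≤ 1) :
    ∃ x, N.leaf x ∈ S ∧ (S = {N.leaf x} ∨ Dia N x) :=
  pendant_aux h _ S a b rfl hP hl

theorem Net2.central {X : Type} [Fintype X] {N : LabGraph X} (h : Net2 N)
    (hX : Fintype.card X ≤ 3) :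
    (∃ x, Dia N x) ∨ TEC N.G (Finset.univ.filter (fun v => v ∉ Set.range N.leaf)) := by
  set W := Finset.univ.filter (fun v => v ∉ Set.range N.leaf) with hWdef
  have hmW : ∀ v, v ∈ W ↔ v ∉ Set.range N.leaf := by
    intro v
    rw [hWdef, Finset.mem_filter]
    simp
  by_contra hcon
  push Not at hcon
  obtain ⟨hD, hT⟩ := hcon
  unfold TEC at hT
  push Not at hT
  obtain ⟨A, hAW, ⟨e, he⟩, hAne, hA⟩ := hT
  obtain ⟨f, hfW, hfA⟩ : ∃ f ∈ W, f ∉ A := by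
    by_contra hh
    push Not at hh
    exact hAne (Finset.Subset.antisymm hAW hh)
  set T := A ∪ Finset.univ.filter (fun v => v ∈ Set.range N.leaf ∧ ∃ c ∈ A, N.G.Adj v c) with hTdef
  have hmT : ∀ v, v ∈ T ↔ v ∈ A ∨ (v ∈ Set.range N.leaf ∧ ∃ c ∈ A, N.G.Adj v c) := by
    intro v
    rw [hTdef, Finset.mem_union, Finset.mem_filter]
    simp
  have hcross : ∀ c ∈ T, ∀ d, d ∉ T → N.G.Adj c d → c ∈ A ∧ d ∈ W ∧ d ∉ A := by
    intro c hc d hd hcd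
    have hdA : d ∉ A := fun hh => hd ((hmT d).2 (Or.inl hh))
    rcases (hmT c).1 hc with h1 | ⟨⟨x, rfl⟩, e, heA, hce⟩
    · refine ⟨h1, ?_, hdA⟩
      exact (hmW d).2 (fun hdl => hd ((hmT d).2 (Or.inr ⟨hdl, c, h1, hcd.symm⟩)))
    · have := h.leaf_uniq x hcd hce
      subst this
      exact absurd heA hdA
  have heT : e ∈ T := (hmT e).2 (Or.inl he)
  have hfT : f ∉ T := by
    intro hh
    rcases (hmT f).1 hh with h1 | h1
    · exact hfA h1
    · exact (hmW f).1 hfW h1.1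
  obtain ⟨c, hc, d, hd, hcd⟩ := conn_cut h.conn (T : Set N.V) ⟨e, heT⟩
    (fun hu => hfT (by
      have : f ∈ (T : Set N.V) := hu ▸ Set.mem_univ _
      exact this))
  have hc : c ∈ T := hc
  have hd : d ∉ T := hd
  have h1 := hcross c hc d hd hcd
  have huniq : ∀ c' ∈ T, ∀ d', d' ∉ T → N.G.Adj c' d' → c' = c ∧ d' = d := by
    intro c' hc' d' hd' hcd'
    have h2 := hcross c' hc' d' hd' hcd'
    have h3 := hA c h1.1 d h1.2.1 c' h2.1 d' h2.2.1 h1.2.2 h2.2.2 hcd hcd'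
    exact ⟨h3.1.symm, h3.2.symm⟩
  have hcards : (Finset.univ.filter (fun x => N.leaf x ∈ T)).card +
      (Finset.univ.filter (fun x => N.leaf x ∈ Tᶜ)).card ≤ 3 := by
    refine le_trans (le_of_eq ?_) hX
    have := Finset.card_filter_add_card_filter_not (s := (Finset.univ : Finset X)) (fun x => N.leaf x ∈ T)
    simpa using this
  have fin : ∀ S : Finset N.V, ∀ a b g, g ∈ S → g ∈ W → Pend N.G S a b →
      ¬ (Finset.univ.filter (fun x => N.leaf x ∈ S)).card ≤ 1 := by
    intro S a b g hgS hgW hP hl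
    obtain ⟨x, hx, h2 | h2⟩ := h.pendant S a b hP hl
    · rw [h2] at hgS
      exact (hmW g).1 hgW ⟨x, (Finset.mem_singleton.1 hgS).symm⟩
    · exact hD x h2
  have f1 := fin T c d e heT (hAW he) ⟨hc, hd, hcd, huniq⟩
  have f2 := fin Tᶜ d c f (by simpa using hfT) hfW ⟨by simpa using hd, by simpa using hc, hcd.symm,
    fun d' hd' c' hc' hdc => by
      have := huniq c' (by simpa using hc') d' (by simpa using hd') hdc.symm
      exact ⟨this.2, this.1⟩⟩
  omega

/-- Label-preserving isomorphism (without instance arguments). -/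
def Iso {X : Type} (N M : LabGraph X) : Prop :=
  ∃ φ : N.G ≃g M.G, ∀ x : X, φ (N.leaf x) = M.leaf x

theorem Iso.symm {X : Type} {N M : LabGraph X} (h : Iso N M) : Iso M N := by
  obtain ⟨φ, hφ⟩ := h
  exact ⟨φ.symm, fun x => by rw [← hφ x]; exact φ.symm_apply_apply _⟩

theorem Iso.trans {X : Type} {N M K : LabGraph X} (h : Iso N M) (h' : Iso M K) : Iso N K := by
  obtain ⟨φ, hφ⟩ := h
  obtain ⟨ψ, hψ⟩ := h'
  exact ⟨φ.trans ψ, fun x => by rw [← hψ x, ← hφ x]; rfl⟩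

theorem walk_lip {V : Type} {G : SimpleGraph V} {f : V → ℕ}
    (hf : ∀ a b, G.Adj a b → f b ≤ f a + 1) {s t : V} (w : G.Walk s t) :
    f t ≤ f s + w.length := by
  induction w with
  | nil => simp
  | cons h p ih =>
    have := hf _ _ h
    rw [SimpleGraph.Walk.length_cons]
    omega

theorem dist_of_lip {V : Type} {G : SimpleGraph V} {f : V → ℕ}
    (hf : ∀ a b, G.Adj a b → f b ≤ f a + 1) {s t : V} (w : G.Walk s t) (hs : f s = 0)
    (hw : w.length ≤ f t) : G.dist s t = f t := by
  apply le_antisymm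
  · exact (SimpleGraph.dist_le w).trans hw
  · obtain ⟨w', hw'⟩ := w.reachable.exists_walk_length_eq_dist
    have := walk_lip hf w'
    omega

theorem dist_lip {V : Type} {G : SimpleGraph V} (hG : G.Connected) (s a b : V) (h : G.Adj a b) :
    G.dist s b ≤ G.dist s a + 1 := by
  have h1 := hG.dist_triangle (u := s) (v := a) (w := b)
  rw [SimpleGraph.dist_eq_one_iff_adj.2 h] at h1
  exact h1

theorem Iso.dist {X : Type} {N M : LabGraph X} (h : Iso N M) (hN : N.G.Connected) (x y : X) :
    N.G.dist (N.leaf x) (N.leaf y) = M.G.dist (M.leaf x) (M.leaf y) := by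
  obtain ⟨φ, hφ⟩ := h
  obtain ⟨w, hw⟩ := hN.exists_walk_length_eq_dist (N.leaf x) (N.leaf y)
  have h1 := dist_of_lip (G := M.G) (f := fun v => N.G.dist (N.leaf x) (φ.symm v))
    (fun a b hab => dist_lip hN _ _ _ (φ.symm.map_adj_iff.2 hab)) (w.map φ.toHom)
    (by
      show N.G.dist (N.leaf x) (φ.symm (φ (N.leaf x))) = 0
      simp)
    (by
      show _ ≤ N.G.dist (N.leaf x) (φ.symm (φ (N.leaf y)))
      simp [hw])
  rw [← hφ x, ← hφ y]
  refine Eq.trans ?_ h1.symm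
  show _ = N.G.dist (N.leaf x) (φ.symm (φ (N.leaf y)))
  simp

/-- Adjacency of the four new vertices. -/
def fad (i j : Fin 4) : Prop := i ≠ j ∧ ((i ≤ 2 ∧ j ≤ 2) ∨ (2 ≤ i ∧ 2 ≤ j))

/-- Adjacency after growing a diamond at the vertex `u`. -/
def dxAdj {V : Type} (G : SimpleGraph V) (u : V) : V ⊕ Fin 4 → V ⊕ Fin 4 → Prop
  | Sum.inl a, Sum.inl b => G.Adj a b
  | Sum.inl a, Sum.inr i => a = u ∧ (i = 0 ∨ i = 1)
  | Sum.inr i, Sum.inl a => a = u ∧ (i = 0 ∨ i = 1)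
  | Sum.inr i, Sum.inr j => fad i j

/-- Growing a diamond at the leaf `x`. -/
noncomputable def Dx {X : Type} (M : LabGraph X) (x : X) : LabGraph X where
  V := M.V ⊕ Fin 4
  G :=
    { Adj := dxAdj M.G (M.leaf x)
      symm := ⟨by
        rintro (a | i) (b | j) h
        · exact (show M.G.Adj a b from h).symm
        · exact h
        · exact h
        · exact ⟨h.1.symm, by have := h.2; tauto⟩⟩
      loopless := ⟨by
        rintro (a | i) h
        · exact M.G.loopless.irrefl a h
        · exact h.1 rfl⟩ }
  leaf := fun y => if y = x then Sum.inr 3 else Sum.inl (M.leaf y)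

theorem Dx_iso {X : Type} {M M' : LabGraph X} (x : X) (h : Iso M M') :
    Iso (Dx M x) (Dx M' x) := by
  obtain ⟨φ, hφ⟩ := h
  refine ⟨⟨Equiv.sumCongr φ.toEquiv (Equiv.refl _), ?_⟩, ?_⟩
  · rintro (a | i) (b | j)
    · exact φ.map_adj_iff
    · show (φ a = M'.leaf x ∧ _) ↔ (a = M.leaf x ∧ _)
      rw [← hφ x, φ.injective.eq_iff]; rfl
    · show (φ b = M'.leaf x ∧ _) ↔ (b = M.leaf x ∧ _)
      rw [← hφ x, φ.injective.eq_iff]; rfl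
    · exact Iff.rfl
  · intro y
    show Equiv.sumCongr φ.toEquiv (Equiv.refl _) (if y = x then Sum.inr 3 else Sum.inl (M.leaf y)) =
      (if y = x then Sum.inr 3 else Sum.inl (M'.leaf y))
    split_ifs
    · rfl
    · rw [← hφ y]; rfl

/-- The inclusion of the old network. -/
def dxHom {X : Type} (M : LabGraph X) (x : X) : M.G →g (Dx M x).G where
  toFun := Sum.inl
  map_rel' := fun h => h

theorem Dx_dist_old {X : Type} {M : LabGraph X} (hM : M.G.Connected) (x y z : X)
    (hy : y ≠ x) (hz : z ≠ x) :
    (Dx M x).G.dist ((Dx M x).leaf y) ((Dx M x).leaf z) = M.G.dist (M.leaf y) (M.leaf z) := by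
  obtain ⟨w, hw⟩ := hM.exists_walk_length_eq_dist (M.leaf y) (M.leaf z)
  have e1 : (Dx M x).leaf y = Sum.inl (M.leaf y) := if_neg hy
  have e2 : (Dx M x).leaf z = Sum.inl (M.leaf z) := if_neg hz
  rw [e1, e2]
  refine dist_of_lip (G := (Dx M x).G) (f := Sum.elim (fun v => M.G.dist (M.leaf y) v)
    (fun i => M.G.dist (M.leaf y) (M.leaf x) + ![1, 1, 2, 3] i)) ?_ (w.map (dxHom M x)) ?_ ?_
  · rintro (a | i) (b | j) h
    · exact dist_lip hM _ _ _ h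
    · obtain ⟨rfl, rfl | rfl⟩ := h <;> simp
    · obtain ⟨rfl, rfl | rfl⟩ := h <;> simp <;> omega
    · change fad i j at h
      unfold fad at h
      revert h
      simp only [Sum.elim_inr]
      generalize M.G.dist (M.leaf y) (M.leaf x) = D
      fin_cases i <;> fin_cases j <;> simp <;> omega
  · simp
  · simp [hw, dxHom]

theorem Dx_dist_new {X : Type} {M : LabGraph X} (hM : M.G.Connected) (x y : X)
    (hy : y ≠ x) :
    (Dx M x).G.dist ((Dx M x).leaf y) ((Dx M x).leaf x) = M.G.dist (M.leaf y) (M.leaf x) + 3 := by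
  obtain ⟨w, hw⟩ := hM.exists_walk_length_eq_dist (M.leaf y) (M.leaf x)
  have e1 : (Dx M x).leaf y = Sum.inl (M.leaf y) := if_neg hy
  have e2 : (Dx M x).leaf x = Sum.inr 3 := if_pos rfl
  rw [e1, e2]
  have a1 : (Dx M x).G.Adj (Sum.inl (M.leaf x)) (Sum.inr 0) := ⟨rfl, Or.inl rfl⟩
  have a2 : (Dx M x).G.Adj (Sum.inr 0) (Sum.inr 2) := by
    show fad 0 2
    unfold fad; decide
  have a3 : (Dx M x).G.Adj (Sum.inr 2) (Sum.inr 3) := by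
    show fad 2 3
    unfold fad; decide
  refine dist_of_lip (G := (Dx M x).G) (f := Sum.elim (fun v => M.G.dist (M.leaf y) v)
    (fun i => M.G.dist (M.leaf y) (M.leaf x) + ![1, 1, 2, 3] i)) ?_
    ((w.map (dxHom M x)).append (SimpleGraph.Walk.cons a1 (SimpleGraph.Walk.cons a2
      (SimpleGraph.Walk.cons a3 SimpleGraph.Walk.nil)))) ?_ ?_
  · rintro (a | i) (b | j) h
    · exact dist_lip hM _ _ _ h
    · obtain ⟨rfl, rfl | rfl⟩ := h <;> simp
    · obtain ⟨rfl, rfl | rfl⟩ := h <;> simp <;> omega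
    · change fad i j at h
      unfold fad at h
      revert h
      simp only [Sum.elim_inr]
      generalize M.G.dist (M.leaf y) (M.leaf x) = D
      fin_cases i <;> fin_cases j <;> simp <;> omega
  · simp
  · refine le_of_eq ((SimpleGraph.Walk.length_append _ _).trans ?_)
    have e3 : (w.map (dxHom M x)).length = w.length := SimpleGraph.Walk.length_map _ _
    refine (congrArg (fun t => t + 3) (e3.trans hw))

theorem Dia.Dx {X : Type} {M : LabGraph X} {x y : X} (hy : y ≠ x) (h : Dia M y) :
    Dia (Dx M x) y := by
  obtain ⟨p, c, d, u, h1, h2, h3, h4, h5, h6, h7⟩ := h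
  have e1 : (LabGraph.Dx M x).leaf y = Sum.inl (M.leaf y) := if_neg hy
  refine ⟨Sum.inl p, Sum.inl c, Sum.inl d, Sum.inl u, ?_, h2, h3, h4, h5, h6,
    fun e => h7 (Sum.inl_injective e)⟩
  rw [e1]
  exact h1

theorem Dia.iso {X : Type} {N M : LabGraph X} (h : Iso N M) {x : X} (hd : Dia N x) : Dia M x := by
  obtain ⟨p, c, d, u, h1, h2, h3, h4, h5, h6, h7⟩ := hd
  obtain ⟨φ, hφ⟩ := h
  refine ⟨φ p, φ c, φ d, φ u, ?_, φ.map_adj_iff.2 h2, φ.map_adj_iff.2 h3, φ.map_adj_iff.2 h4,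
    φ.map_adj_iff.2 h5, φ.map_adj_iff.2 h6, fun e => h7 (φ.injective e)⟩
  rw [← hφ x]
  exact φ.map_adj_iff.2 h1

theorem dg_map {V V' : Type} (G : SimpleGraph V) (f : V' ↪ V) (W : Finset V') (v : V') :
    dg (G.comap f) W v = dg G (W.map f) (f v) := by
  unfold dg
  rw [Finset.filter_map, Finset.card_map]
  rfl

theorem ee_map {V V' : Type} (G : SimpleGraph V) (f : V' ↪ V) (W : Finset V') :
    ee (G.comap f) W = ee G (W.map f) := by
  unfold ee
  rw [Finset.sum_map]
  exact Finset.sum_congr rfl (fun v _ => dg_map G f W v)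

theorem CC_map {V V' : Type} (G : SimpleGraph V) (f : V' ↪ V) (W : Finset V')
    (h : CC (G.comap f) W) : CC G (W.map f) := by
  refine ⟨h.1.map, fun A hA hAn hne => ?_⟩
  have hAe : A = (W.filter (fun v => f v ∈ A)).map f := by
    ext v
    simp only [Finset.mem_map, Finset.mem_filter]
    constructor
    · intro hv
      obtain ⟨w, hw, rfl⟩ := Finset.mem_map.1 (hA hv)
      exact ⟨w, ⟨hw, hv⟩, rfl⟩
    · rintro ⟨w, ⟨_, hw⟩, rfl⟩
      exact hw
  obtain ⟨a, ha, b, hb, hbA, hab⟩ := h.2 (W.filter (fun v => f v ∈ A)) (Finset.filter_subset _ _)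
    (by
      rw [hAe] at hAn
      exact Finset.map_nonempty.1 hAn)
    (fun e => hne (by rw [hAe, e]))
  simp only [Finset.mem_filter] at ha hbA
  exact ⟨f a, ha.2, f b, Finset.mem_map_of_mem f hb, fun hh => hbA ⟨hb, hh⟩, hab⟩

theorem CC_map_erase {V V' : Type} (G : SimpleGraph V) (f : V' ↪ V) (W : Finset V') (w : V')
    (h : CC (G.comap f) (W.erase w)) : CC G ((W.map f).erase (f w)) := by
  have := CC_map G f _ h
  rwa [Finset.map_erase] at this

theorem Net2.nbr3 {X : Type} {N : LabGraph X} (h : Net2 N) {v a b c : N.V}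
    (ha : N.G.Adj v a) (hb : N.G.Adj v b) (hc : N.G.Adj v c) (hab : a ≠ b) (hac : a ≠ c)
    (hbc : b ≠ c) (w : N.V) : N.G.Adj v w ↔ w = a ∨ w = b ∨ w = c := by
  have h1 : ({a, b, c} : Finset N.V) ⊆ Finset.univ.filter (fun w => N.G.Adj v w) := by
    intro z hz
    simp only [Finset.mem_insert, Finset.mem_singleton] at hz
    rcases hz with rfl | rfl | rfl <;> simp [*]
  have h2 := Finset.eq_of_subset_of_card_le h1 (by
    rw [Finset.card_eq_three.2 ⟨a, b, c, hab, hac, hbc, rfl⟩]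
    exact h.le3 v)
  have : w ∈ ({a, b, c} : Finset N.V) ↔ w ∈ Finset.univ.filter (fun w => N.G.Adj v w) := by rw [h2]
  simp only [Finset.mem_insert, Finset.mem_singleton, Finset.mem_filter, Finset.mem_univ, true_and] at this
  exact this.symm

theorem Net2.notleaf {X : Type} {N : LabGraph X} (h : Net2 N) {v a b : N.V}
    (ha : N.G.Adj v a) (hb : N.G.Adj v b) (hab : a ≠ b) (x : X) : N.leaf x ≠ v := by
  rintro rfl
  exact hab (h.leaf_uniq x ha hb)

theorem Net2.peel {X : Type} {N : LabGraph X} (h : Net2 N) {x : X} (hd : Dia N x) :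
    ∃ M : LabGraph X, Net2 M ∧ Iso N (Dx M x) ∧ Fintype.card M.V < Fintype.card N.V := by
  obtain ⟨p, c, d, u, hlp, hpc, hpd, hcd, hcu, hdu, hpu⟩ := hd
  set l := N.leaf x
  have nlp := h.notleaf hpc hpd hcd.ne
  have nlc := h.notleaf hpc.symm hcu hpu
  have nld := h.notleaf hpd.symm hdu hpu
  have nlu := h.notleaf hcu.symm hdu.symm hcd.ne
  have al : ∀ w, N.G.Adj l w ↔ w = p := fun w =>
    ⟨fun hw => h.leaf_uniq x hw hlp, fun e => e ▸ hlp⟩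
  have ap := fun w => h.nbr3 hlp.symm hpc hpd (nlc x) (nld x) hcd.ne w
  have ac := fun w => h.nbr3 hpc.symm hcd hcu hpd.ne hpu hdu.ne w
  have ad := fun w => h.nbr3 hpd.symm hcd.symm hdu hpc.ne hpu hcu.ne w
  have lp : l ≠ p := nlp x
  have lc : l ≠ c := nlc x
  have ld : l ≠ d := nld x
  have lu : l ≠ u := nlu x
  have pc := hpc.ne
  have pd := hpd.ne
  have cd := hcd.ne
  have cu := hcu.ne
  have du := hdu.ne
  let P : N.V → Prop := fun v => v ≠ l ∧ v ≠ p ∧ v ≠ c ∧ v ≠ d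
  have hPu : P u := ⟨lu.symm, hpu.symm, cu.symm, du.symm⟩
  have hPl : ∀ y, y ≠ x → P (N.leaf y) := fun y hy =>
    ⟨fun e => hy (h.inj e), nlp y, nlc y, nld y⟩
  let f : {v // P v} ↪ N.V := Function.Embedding.subtype P
  let M : LabGraph X :=
    { V := {v // P v}
      fV := Subtype.fintype P
      G := N.G.comap f
      leaf := fun y => if hy : y = x then ⟨u, hPu⟩ else ⟨N.leaf y, hPl y hy⟩ }
  have Mx : M.leaf x = ⟨u, hPu⟩ := dif_pos rfl
  have My : ∀ y (hy : y ≠ x), M.leaf y = ⟨N.leaf y, hPl y hy⟩ := fun y hy => dif_neg hy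
  have hnadj : ∀ v, P v → v ≠ u → ¬ N.G.Adj v l ∧ ¬ N.G.Adj v p ∧ ¬ N.G.Adj v c ∧ ¬ N.G.Adj v d := by
    rintro v ⟨h1, h2, h3, h4⟩ hvu
    refine ⟨fun e => ?_, fun e => ?_, fun e => ?_, fun e => ?_⟩
    · have := (al v).1 e.symm; tauto
    · have := (ap v).1 e.symm; tauto
    · have := (ac v).1 e.symm; tauto
    · have := (ad v).1 e.symm; tauto
  have hmapu : (Finset.univ : Finset M.V).map f = ({l, p, c, d} : Finset N.V)ᶜ := by
    ext v
    simp only [Finset.mem_map, Finset.mem_univ, true_and, Finset.mem_compl, Finset.mem_insert,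
      Finset.mem_singleton, not_or]
    constructor
    · rintro ⟨w, rfl⟩
      exact w.2
    · intro hv
      exact ⟨⟨v, hv⟩, rfl⟩
  have hdgM : ∀ v : M.V, v.1 ≠ u → dg M.G Finset.univ v = dg N.G Finset.univ v.1 := by
    intro v hv
    have h1 : dg M.G Finset.univ v = dg N.G ({l, p, c, d} : Finset N.V)ᶜ v.1 := by
      rw [← hmapu]
      exact dg_map N.G f Finset.univ v
    have h2 := dg_split N.G ({l, p, c, d} : Finset N.V) v.1
    have h3 : dg N.G ({l, p, c, d} : Finset N.V) v.1 = 0 := by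
      apply Finset.card_eq_zero.2
      rw [Finset.filter_eq_empty_iff]
      have := hnadj v.1 v.2 hv
      intro w hw
      simp only [Finset.mem_insert, Finset.mem_singleton] at hw
      rcases hw with rfl | rfl | rfl | rfl
      · exact this.1
      · exact this.2.1
      · exact this.2.2.1
      · exact this.2.2.2
    omega
  refine ⟨M, ⟨?_, ?_, ?_, ?_, ?_⟩, ?_, ?_⟩
  · -- connected
    have : Nonempty M.V := ⟨⟨u, hPu⟩⟩
    refine cut_conn fun A hA hne => ?_
    obtain ⟨t0, ht0⟩ : ∃ t : M.V, t ∉ A := by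
      by_contra hh
      push Not at hh
      exact hne (Set.eq_univ_of_forall hh)
    obtain ⟨s0, hs0⟩ := hA
    by_cases huA : (⟨u, hPu⟩ : M.V) ∈ A
    · obtain ⟨s, hs, t, ht, hst⟩ := conn_cut h.conn {v | ∀ hv : P v, (⟨v, hv⟩ : M.V) ∈ A}
        ⟨s0.1, fun _ => hs0⟩ (fun hu => ht0 (by
          have : t0.1 ∈ {v | ∀ hv : P v, (⟨v, hv⟩ : M.V) ∈ A} := hu ▸ Set.mem_univ _
          exact this t0.2))
      simp only [Set.mem_setOf_eq, not_forall] at hs ht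
      obtain ⟨htP, htA⟩ := ht
      have hsP : P s := by
        by_contra hns
        have h1 : s = l ∨ s = p ∨ s = c ∨ s = d := by
          by_contra hh
          push Not at hh
          exact hns hh
        have htu : t ≠ u := by
          rintro rfl
          exact htA huA
        have h2 := hnadj t htP htu
        have := hst.symm
        rcases h1 with rfl | rfl | rfl | rfl <;> tauto
      exact ⟨⟨s, hsP⟩, hs hsP, ⟨t, htP⟩, htA, hst⟩
    · obtain ⟨s, hs, t, ht, hst⟩ := conn_cut h.conn {v | ∃ hv : P v, (⟨v, hv⟩ : M.V) ∈ A}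
        ⟨s0.1, s0.2, hs0⟩ (fun hu => ht0 (by
          have : t0.1 ∈ {v | ∃ hv : P v, (⟨v, hv⟩ : M.V) ∈ A} := hu ▸ Set.mem_univ _
          exact this.2))
      simp only [Set.mem_setOf_eq, not_exists] at hs ht
      obtain ⟨hsP, hsA⟩ := hs
      have htP : P t := by
        by_contra hns
        have h1 : t = l ∨ t = p ∨ t = c ∨ t = d := by
          by_contra hh
          push Not at hh
          exact hns hh
        have hsu : s ≠ u := by
          rintro rfl
          exact huA hsA
        have h2 := hnadj s hsP hsu
        rcases h1 with rfl | rfl | rfl | rfl <;> tauto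
      exact ⟨⟨s, hsP⟩, hsA, ⟨t, htP⟩, ht htP, hst⟩
  · -- injective
    intro y z hyz
    by_cases hy : y = x <;> by_cases hz : z = x
    · rw [hy, hz]
    · subst hy
      rw [Mx, My z hz] at hyz
      exact absurd (congrArg Subtype.val hyz).symm (nlu z)
    · subst hz
      rw [Mx, My y hy] at hyz
      exact absurd (congrArg Subtype.val hyz) (nlu y)
    · rw [My y hy, My z hz] at hyz
      exact h.inj (congrArg Subtype.val hyz)
  · -- degree 1
    intro y
    by_cases hy : y = x
    · subst hy
      rw [Mx]
      have h1 : dg M.G Finset.univ ⟨u, hPu⟩ = dg N.G ({l, p, c, d} : Finset N.V)ᶜ u := by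
        rw [← hmapu]
        exact dg_map N.G f Finset.univ ⟨u, hPu⟩
      have h2 := dg_split N.G ({l, p, c, d} : Finset N.V) u
      have h3 : dg N.G ({l, p, c, d} : Finset N.V) u = 2 := by
        unfold dg
        rw [← Finset.card_pair cd]
        congr 1
        ext w
        simp only [Finset.mem_filter, Finset.mem_insert, Finset.mem_singleton]
        constructor
        · rintro ⟨rfl | rfl | rfl | rfl, hadj⟩
          · have := (al u).1 hadj.symm
            exact absurd this.symm hpu
          · have := (ap u).1 hadj.symm
            rcases this with e | e | e
            · exact absurd e.symm lu
            · exact absurd e.symm cu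
            · exact absurd e.symm du
          · exact Or.inl rfl
          · exact Or.inr rfl
        · rintro (rfl | rfl)
          · exact ⟨by tauto, hcu.symm⟩
          · exact ⟨by tauto, hdu.symm⟩
      have h4 := h.deg3 u (by rintro ⟨y, hy⟩; exact nlu y hy)
      refine h1.trans ?_
      omega
    · rw [My y hy]
      exact (hdgM ⟨N.leaf y, hPl y hy⟩ (nlu y)).trans (h.deg1 y)
  · -- degree 3
    intro v hv
    have hvu : v.1 ≠ u := by
      intro e
      apply hv
      refine ⟨x, ?_⟩
      rw [Mx]
      exact Subtype.ext e.symm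
    rw [hdgM v hvu]
    apply h.deg3
    rintro ⟨y, hy⟩
    by_cases hyx : y = x
    · subst hyx
      exact v.2.1 hy.symm
    · apply hv
      refine ⟨y, ?_⟩
      rw [My y hyx]
      exact Subtype.ext hy
  · -- level
    intro W h3 hc hv
    have h1 := h.lev (W.map f) (by rw [Finset.card_map]; exact h3) (CC_map N.G f W hc) (by
      intro v hvW
      obtain ⟨w, hw, rfl⟩ := Finset.mem_map.1 hvW
      exact CC_map_erase N.G f _ _ (hv w hw))
    rw [Finset.card_map, ← ee_map] at h1
    exact h1
  · -- iso
    let g : (Dx M x).V → N.V := Sum.elim (fun v : {v // P v} => v.1) ![c, d, p, l]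
    have hg : Function.Bijective g := by
      constructor
      · rintro (⟨a, ha1, ha2, ha3, ha4⟩ | i) (⟨b, hb1, hb2, hb3, hb4⟩ | j) hab
        · have : a = b := hab
          subst this
          rfl
        · exfalso
          change a = ![c, d, p, l] j at hab
          fin_cases j
          · exact ha3 hab
          · exact ha4 hab
          · exact ha2 hab
          · exact ha1 hab
        · exfalso
          change ![c, d, p, l] i = b at hab
          fin_cases i
          · exact hb3 hab.symm
          · exact hb4 hab.symm
          · exact hb2 hab.symm
          · exact hb1 hab.symm
        · change ![c, d, p, l] i = ![c, d, p, l] j at hab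
          congr 1
          fin_cases i <;> fin_cases j <;> simp at hab ⊢ <;>
            first | exact absurd hab (by assumption) | exact absurd hab.symm (by assumption)
      · intro v
        by_cases hv : P v
        · exact ⟨Sum.inl ⟨v, hv⟩, rfl⟩
        · have h1 : v = l ∨ v = p ∨ v = c ∨ v = d := by
            by_contra hh
            push Not at hh
            exact hv hh
          rcases h1 with rfl | rfl | rfl | rfl
          · exact ⟨Sum.inr 3, rfl⟩
          · exact ⟨Sum.inr 2, rfl⟩
          · exact ⟨Sum.inr 0, rfl⟩
          · exact ⟨Sum.inr 1, rfl⟩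
    have hmix : ∀ (a : {v // P v}) (i : Fin 4), N.G.Adj a.1 (![c, d, p, l] i) ↔
        (a = M.leaf x ∧ (i = 0 ∨ i = 1)) := by
      intro a i
      rw [Mx]
      have hau : a = (⟨u, hPu⟩ : M.V) ↔ a.1 = u :=
        ⟨fun e => congrArg Subtype.val e, fun e => Subtype.ext e⟩
      rw [hau]
      obtain ⟨a, ha1, ha2, ha3, ha4⟩ := a
      rw [N.G.adj_comm]
      fin_cases i
      · simp only [Fin.zero_eta, Fin.isValue, Matrix.cons_val_zero]
        rw [ac]; simp [*]
      · show N.G.Adj d a ↔ _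
        rw [ad]; simp [*]
      · show N.G.Adj p a ↔ _
        rw [ap]; simp [*]
      · show N.G.Adj l a ↔ _
        rw [al]; simp [*]
    refine Iso.symm ⟨⟨Equiv.ofBijective g hg, ?_⟩, ?_⟩
    · rintro (a | i) (b | j)
      · exact Iff.rfl
      · exact hmix a j
      · show N.G.Adj (![c, d, p, l] i) b.1 ↔ _
        rw [N.G.adj_comm]
        exact hmix b i
      · show N.G.Adj (![c, d, p, l] i) (![c, d, p, l] j) ↔ fad i j
        unfold fad
        have e1 : ∀ w, N.G.Adj (![c, d, p, l] 0) w ↔ _ := ac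
        have e2 : ∀ w, N.G.Adj (![c, d, p, l] 1) w ↔ _ := ad
        have e3 : ∀ w, N.G.Adj (![c, d, p, l] 2) w ↔ _ := ap
        have e4 : ∀ w, N.G.Adj (![c, d, p, l] 3) w ↔ _ := al
        have := lp.symm
        have := lc.symm
        have := ld.symm
        have := pc.symm
        have := pd.symm
        have := cd.symm
        fin_cases i
        · refine (e1 _).trans ?_
          fin_cases j <;> simp [*]
        · refine (e2 _).trans ?_
          fin_cases j <;> simp [*]
        · refine (e3 _).trans ?_
          fin_cases j <;> simp [*]
        · refine (e4 _).trans ?_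
          fin_cases j <;> simp [*]
    · intro y
      show g ((Dx M x).leaf y) = N.leaf y
      by_cases hy : y = x
      · have e : (Dx M x).leaf y = Sum.inr 3 := if_pos hy
        rw [e, hy]; rfl
      · have e : (Dx M x).leaf y = Sum.inl (M.leaf y) := if_neg hy
        rw [e, My y hy]; rfl
  · -- card
    refine @Fintype.card_lt_of_injective_of_notMem M.V N.V M.fV N.fV (fun v => v.1)
      Subtype.val_injective l ?_
    rintro ⟨v, hv⟩
    exact v.2.1 hv

/-- Number of inner vertices and edge lists of the six base networks. -/
def dat : Fin 6 → ℕ × List (ℕ × ℕ) :=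
  ![(1, [(0, 3), (1, 3), (2, 3)]),
    (3, [(0, 3), (1, 4), (2, 5), (3, 4), (4, 5), (3, 5)]),
    (5, [(0, 3), (1, 4), (2, 5), (6, 3), (6, 4), (6, 5), (7, 3), (7, 4), (7, 5)]),
    (5, [(0, 3), (1, 4), (2, 5), (6, 7), (6, 3), (7, 3), (6, 4), (7, 5), (4, 5)]),
    (5, [(0, 3), (1, 4), (2, 5), (6, 7), (6, 4), (7, 4), (6, 5), (7, 3), (3, 5)]),
    (5, [(0, 3), (1, 4), (2, 5), (6, 7), (6, 5), (7, 5), (6, 3), (7, 4), (3, 4)])]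

/-- Distances 01, 02, 12 of the base networks. -/
def dtab : Fin 6 → ℕ × ℕ × ℕ :=
  ![(2, 2, 2), (3, 3, 3), (4, 4, 4), (4, 4, 3), (4, 3, 4), (3, 4, 4)]

/-- Boolean adjacency of the base networks. -/
def adjb (k : Fin 6) (i j : ℕ) : Bool :=
  (dat k).2.contains (i, j) || (dat k).2.contains (j, i)

theorem adjb_irr : ∀ (k : Fin 6) (i : Fin ((dat k).1 + 3)), adjb k i.1 i.1 = false := by
  decide

/-- The six base networks. -/
def mdl (k : Fin 6) : LabGraph (Fin 3) where
  V := Fin ((dat k).1 + 3)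
  G :=
    { Adj := fun i j => adjb k i.1 j.1 = true
      symm := ⟨fun i j h => by
        unfold adjb at h ⊢
        rw [Bool.or_comm]
        exact h⟩
      loopless := ⟨fun i h => by
        rw [adjb_irr k i] at h
        exact Bool.noConfusion h⟩ }
  leaf := fun i => ⟨i.1, by omega⟩

theorem mdl_deg : ∀ (k : Fin 6) (i : Fin ((dat k).1 + 3)),
    (i.1 < 3 → 1 ≤ (Finset.univ.filter (fun j : Fin ((dat k).1 + 3) => adjb k i.1 j.1 = true)).card) ∧
    (3 ≤ i.1 → 3 ≤ (Finset.univ.filter (fun j : Fin ((dat k).1 + 3) => adjb k i.1 j.1 = true)).card) := by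
  decide

/-- Boolean check of a path. -/
def pathb (k : Fin 6) (t : ℕ) : ℕ → List ℕ → Bool
  | s, [] => s == t
  | s, a :: l => decide (a < (dat k).1 + 3) && (adjb k s a && pathb k t a l)

theorem walk_of (k : Fin 6) (t : Fin ((dat k).1 + 3)) :
    ∀ (l : List ℕ) (s : Fin ((dat k).1 + 3)), pathb k t.1 s.1 l = true →
      ∃ w : (mdl k).G.Walk s t, w.length = l.length := by
  intro l
  induction l with
  | nil =>
    intro s h
    have : s = t := Fin.ext (by simpa [pathb] using h)
    subst this
    exact ⟨SimpleGraph.Walk.nil, rfl⟩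
  | cons a l ih =>
    intro s h
    simp only [pathb, Bool.and_eq_true, decide_eq_true_eq] at h
    obtain ⟨h1, h2, h3⟩ := h
    obtain ⟨w, hw⟩ := ih ⟨a, h1⟩ h3
    have hadj : (mdl k).G.Adj s ⟨a, h1⟩ := h2
    exact ⟨SimpleGraph.Walk.cons hadj w, congrArg (fun n => n + 1) hw⟩

theorem dist_dat (k : Fin 6) (i j : Fin 3) (pot : List ℕ) (path : List ℕ)
    (h1 : pathb k j.1 i.1 path = true)
    (h2 : ∀ a b : Fin ((dat k).1 + 3), adjb k a.1 b.1 = true → pot.getD b.1 0 ≤ pot.getD a.1 0 + 1)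
    (h3 : pot.getD i.1 0 = 0) (h4 : path.length ≤ pot.getD j.1 0) :
    (mdl k).G.dist ((mdl k).leaf i) ((mdl k).leaf j) = pot.getD j.1 0 := by
  obtain ⟨w, hw⟩ := walk_of k ((mdl k).leaf j) path ((mdl k).leaf i) h1
  exact dist_of_lip (G := (mdl k).G) (f := fun a => pot.getD a.1 0) (fun a b hab => h2 a b hab) w h3
    (by rw [hw]; exact h4)

theorem mdl_dist (k : Fin 6) :
    (mdl k).G.dist ((mdl k).leaf 0) ((mdl k).leaf 1) = (dtab k).1 ∧
    (mdl k).G.dist ((mdl k).leaf 0) ((mdl k).leaf 2) = (dtab k).2.1 ∧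
    (mdl k).G.dist ((mdl k).leaf 1) ((mdl k).leaf 2) = (dtab k).2.2 := by
  fin_cases k
  · exact ⟨dist_dat 0 0 1 [0, 2, 2, 1] [3, 1] (by decide) (by decide) rfl (by decide),
      dist_dat 0 0 2 [0, 2, 2, 1] [3, 2] (by decide) (by decide) rfl (by decide),
      dist_dat 0 1 2 [2, 0, 2, 1] [3, 2] (by decide) (by decide) rfl (by decide)⟩
  · exact ⟨dist_dat 1 0 1 [0, 3, 3, 1, 2, 2] [3, 4, 1] (by decide) (by decide) rfl (by decide),
      dist_dat 1 0 2 [0, 3, 3, 1, 2, 2] [3, 5, 2] (by decide) (by decide) rfl (by decide),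
      dist_dat 1 1 2 [3, 0, 3, 2, 1, 2] [4, 5, 2] (by decide) (by decide) rfl (by decide)⟩
  · exact ⟨dist_dat 2 0 1 [0, 4, 4, 1, 3, 3, 2, 2] [3, 6, 4, 1] (by decide) (by decide) rfl (by decide),
      dist_dat 2 0 2 [0, 4, 4, 1, 3, 3, 2, 2] [3, 6, 5, 2] (by decide) (by decide) rfl (by decide),
      dist_dat 2 1 2 [4, 0, 4, 3, 1, 3, 2, 2] [4, 6, 5, 2] (by decide) (by decide) rfl (by decide)⟩
  · exact ⟨dist_dat 3 0 1 [0, 4, 4, 1, 3, 3, 2, 2] [3, 6, 4, 1] (by decide) (by decide) rfl (by decide),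
      dist_dat 3 0 2 [0, 4, 4, 1, 3, 3, 2, 2] [3, 7, 5, 2] (by decide) (by decide) rfl (by decide),
      dist_dat 3 1 2 [4, 0, 3, 3, 1, 2, 2, 3] [4, 5, 2] (by decide) (by decide) rfl (by decide)⟩
  · exact ⟨dist_dat 4 0 1 [0, 4, 3, 1, 3, 2, 3, 2] [3, 7, 4, 1] (by decide) (by decide) rfl (by decide),
      dist_dat 4 0 2 [0, 4, 3, 1, 3, 2, 3, 2] [3, 5, 2] (by decide) (by decide) rfl (by decide),
      dist_dat 4 1 2 [4, 0, 4, 3, 1, 3, 2, 2] [4, 6, 5, 2] (by decide) (by decide) rfl (by decide)⟩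
  · exact ⟨dist_dat 5 0 1 [0, 3, 4, 1, 2, 3, 2, 3] [3, 4, 1] (by decide) (by decide) rfl (by decide),
      dist_dat 5 0 2 [0, 3, 4, 1, 2, 3, 2, 3] [3, 6, 5, 2] (by decide) (by decide) rfl (by decide),
      dist_dat 5 1 2 [3, 0, 4, 2, 1, 3, 3, 2] [4, 7, 5, 2] (by decide) (by decide) rfl (by decide)⟩

theorem dtab_inj : ∀ k k' : Fin 6, dtab k = dtab k' → k = k' := by decide

theorem dtab_bd : ∀ k : Fin 6, 2 ≤ (dtab k).1 ∧ (dtab k).1 ≤ 4 ∧ 2 ≤ (dtab k).2.1 ∧ (dtab k).2.1 ≤ 4 ∧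
    2 ≤ (dtab k).2.2 ∧ (dtab k).2.2 ≤ 4 := by decide

theorem iso_dat {N : LabGraph (Fin 3)} (h : Net2 N) (k : Fin 6) (f : ℕ → N.V)
    (hcard : Fintype.card N.V = (dat k).1 + 3) (hl : ∀ i : Fin 3, f i.1 = N.leaf i)
    (hs : ∀ v, ∃ m < (dat k).1 + 3, f m = v)
    (he : ∀ e ∈ (dat k).2, N.G.Adj (f e.1) (f e.2)) : Iso N (mdl k) := by
  let g : Fin ((dat k).1 + 3) → N.V := fun i => f i.1
  have hg : Function.Bijective g := by
    rw [Fintype.bijective_iff_surjective_and_card]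
    refine ⟨fun v => ?_, by rw [hcard, Fintype.card_fin]⟩
    obtain ⟨m, hm, e⟩ := hs v
    exact ⟨⟨m, hm⟩, e⟩
  have hadj : ∀ i j, adjb k i j = true → N.G.Adj (f i) (f j) := by
    intro i j hij
    unfold adjb at hij
    rw [Bool.or_eq_true, List.contains_iff_mem, List.contains_iff_mem] at hij
    rcases hij with hij | hij
    · exact he _ hij
    · exact (he _ hij).symm
  have hiff : ∀ i j : Fin ((dat k).1 + 3), N.G.Adj (g i) (g j) ↔ adjb k i.1 j.1 = true := by
    intro i j
    refine ⟨fun hij => ?_, hadj _ _⟩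
    have hsub : (Finset.univ.filter (fun j : Fin ((dat k).1 + 3) => adjb k i.1 j.1 = true)).image g ⊆
        Finset.univ.filter (fun w => N.G.Adj (g i) w) := by
      intro w hw
      obtain ⟨j, hj, rfl⟩ := Finset.mem_image.1 hw
      simp only [Finset.mem_filter, Finset.mem_univ, true_and] at hj ⊢
      exact hadj _ _ hj
    have hle : dg N.G Finset.univ (g i) ≤
        (Finset.univ.filter (fun j : Fin ((dat k).1 + 3) => adjb k i.1 j.1 = true)).card := by
      by_cases hi : i.1 < 3
      · have e : g i = N.leaf ⟨i.1, hi⟩ := hl ⟨i.1, hi⟩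
        rw [e, h.deg1]
        exact (mdl_deg k i).1 hi
      · exact (h.le3 _).trans ((mdl_deg k i).2 (by omega))
    have heq := Finset.eq_of_subset_of_card_le hsub (by
      rw [Finset.card_image_of_injective _ hg.1]
      exact hle)
    have hmem : g j ∈ Finset.univ.filter (fun w => N.G.Adj (g i) w) := by simpa using hij
    rw [← heq] at hmem
    obtain ⟨j', hj', e⟩ := Finset.mem_image.1 hmem
    rw [← hg.1 e]
    simpa using hj'
  refine Iso.symm ⟨⟨Equiv.ofBijective g hg, fun {a b} => hiff a b⟩, fun i => hl i⟩

/-- `N` is one of the six base networks. -/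
def Base (N : LabGraph (Fin 3)) : Prop := ∃ k : Fin 6, Iso N (mdl k)

theorem two_of {V : Type} {G : SimpleGraph V} {W : Finset V} {w a b : V} (h : 2 ≤ dg G W w)
    (hs : ∀ z ∈ W, G.Adj w z → z = a ∨ z = b) : G.Adj w a ∧ G.Adj w b := by
  have h1 : W.filter (fun z => G.Adj w z) ⊆ {a, b} := by
    intro z hz
    simp only [Finset.mem_filter] at hz
    simp only [Finset.mem_insert, Finset.mem_singleton]
    exact hs z hz.1 hz.2
  have h2 := Finset.eq_of_subset_of_card_le h1 (Finset.card_le_two.trans h)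
  have ha : a ∈ W.filter (fun z => G.Adj w z) := by rw [h2]; simp
  have hb : b ∈ W.filter (fun z => G.Adj w z) := by rw [h2]; simp
  simp only [Finset.mem_filter] at ha hb
  exact ⟨ha.2, hb.2⟩

theorem dg_three {V : Type} {G : SimpleGraph V} {W : Finset V} {w a b c : V} (ha : a ∈ W)
    (hb : b ∈ W) (hc : c ∈ W) (ha' : G.Adj w a) (hb' : G.Adj w b) (hc' : G.Adj w c)
    (hab : a ≠ b) (hac : a ≠ c) (hbc : b ≠ c) : 3 ≤ dg G W w := by
  rw [← Finset.card_eq_three.2 ⟨a, b, c, hab, hac, hbc, rfl⟩]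
  apply Finset.card_le_card
  intro z hz
  simp only [Finset.mem_insert, Finset.mem_singleton] at hz
  rcases hz with rfl | rfl | rfl <;> simp [*]

theorem dg_miss {V : Type} {G : SimpleGraph V} {W : Finset V} {w a b : V} (hW : W.card = 5)
    (h : 3 ≤ dg G W w) (hw : w ∈ W) (ha : a ∈ W) (hb : b ∈ W) (haw : a ≠ w) (hbw : b ≠ w)
    (ha' : ¬ G.Adj w a) (hb' : ¬ G.Adj w b) : a = b := by
  by_contra hab
  have h1 : W.filter (fun z => G.Adj w z) ⊆ W \ {w, a, b} := by
    intro z hz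
    simp only [Finset.mem_filter] at hz
    simp only [Finset.mem_sdiff, Finset.mem_insert, Finset.mem_singleton, not_or]
    refine ⟨hz.1, hz.2.ne', ?_, ?_⟩
    · rintro rfl; exact ha' hz.2
    · rintro rfl; exact hb' hz.2
  have h2 := Finset.card_le_card h1
  have h3 : ({w, a, b} : Finset V) ⊆ W := by
    intro z hz
    simp only [Finset.mem_insert, Finset.mem_singleton] at hz
    rcases hz with rfl | rfl | rfl <;> assumption
  rw [Finset.card_sdiff_of_subset h3, Finset.card_eq_three.2 ⟨w, a, b, haw.symm, hbw.symm, hab, rfl⟩] at h2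
  unfold dg at h
  omega

theorem third : ∀ i j : Fin 3, ∃ k, k ≠ i ∧ k ≠ j := by decide

theorem third' : ∀ i j : Fin 3, i ≠ j → ∃ k, k ≠ i ∧ k ≠ j ∧ ∀ m, m = i ∨ m = j ∨ m = k := by decide

theorem others : ∀ i : Fin 3, ∃ a b, a ≠ i ∧ b ≠ i ∧ a ≠ b ∧ ∀ m, m = i ∨ m = a ∨ m = b := by decide

theorem theta_ex {N : LabGraph (Fin 3)} (h : Net2 N) (p : Fin 3 → N.V) (u v : N.V)
    (hcard : Fintype.card N.V = 8) (hp : ∀ i, N.G.Adj (N.leaf i) (p i))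
    (hs : ∀ w, (∃ i, w = N.leaf i) ∨ (∃ i, w = p i) ∨ w = u ∨ w = v)
    (huv : N.G.Adj u v) (i j k : Fin 3) (hij : i ≠ j) (hki : k ≠ i) (hkj : k ≠ j)
    (huj : N.G.Adj u (p j)) (huk : N.G.Adj u (p k)) (hvi : N.G.Adj v (p i))
    (hvk : N.G.Adj v (p k)) (hpij : N.G.Adj (p i) (p j)) : Base N := by
  have hsur : ∀ (f : ℕ → N.V), (∀ i : Fin 3, f i.1 = N.leaf i) → (∀ i : Fin 3, f (i.1 + 3) = p i) →
      ((f 6 = u ∧ f 7 = v) ∨ (f 6 = v ∧ f 7 = u)) → ∀ w, ∃ m < 5 + 3, f m = w := by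
    intro f h1 h2 h3 w
    rcases hs w with ⟨i, rfl⟩ | ⟨i, rfl⟩ | rfl | rfl
    · exact ⟨i.1, by omega, h1 i⟩
    · exact ⟨i.1 + 3, by omega, h2 i⟩
    · rcases h3 with h3 | h3
      · exact ⟨6, by omega, h3.1⟩
      · exact ⟨7, by omega, h3.2⟩
    · rcases h3 with h3 | h3
      · exact ⟨7, by omega, h3.2⟩
      · exact ⟨6, by omega, h3.1⟩
  have f1 : ∀ (a b : N.V) (i : Fin 3), (fun m => [N.leaf 0, N.leaf 1, N.leaf 2, p 0, p 1, p 2, a, b].getD m u) i.1 = N.leaf i := by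
    intro a b i
    fin_cases i <;> rfl
  have f2 : ∀ (a b : N.V) (i : Fin 3), (fun m => [N.leaf 0, N.leaf 1, N.leaf 2, p 0, p 1, p 2, a, b].getD m u) (i.1 + 3) = p i := by
    intro a b i
    fin_cases i <;> rfl
  have main : ∀ q : Fin 6, (dat q).1 = 5 →
      ((∀ e ∈ (dat q).2, N.G.Adj ([N.leaf 0, N.leaf 1, N.leaf 2, p 0, p 1, p 2, u, v].getD e.1 u)
        ([N.leaf 0, N.leaf 1, N.leaf 2, p 0, p 1, p 2, u, v].getD e.2 u)) ∨
       (∀ e ∈ (dat q).2, N.G.Adj ([N.leaf 0, N.leaf 1, N.leaf 2, p 0, p 1, p 2, v, u].getD e.1 u)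
        ([N.leaf 0, N.leaf 1, N.leaf 2, p 0, p 1, p 2, v, u].getD e.2 u))) → Base N := by
    intro q hq hh
    refine ⟨q, ?_⟩
    rcases hh with hh | hh
    · refine iso_dat h q (fun m => [N.leaf 0, N.leaf 1, N.leaf 2, p 0, p 1, p 2, u, v].getD m u)
        (by rw [hq, hcard]) (f1 u v) ?_ hh
      rw [hq]
      exact hsur _ (f1 u v) (f2 u v) (Or.inl ⟨rfl, rfl⟩)
    · refine iso_dat h q (fun m => [N.leaf 0, N.leaf 1, N.leaf 2, p 0, p 1, p 2, v, u].getD m u)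
        (by rw [hq, hcard]) (f1 v u) ?_ hh
      rw [hq]
      exact hsur _ (f1 v u) (f2 v u) (Or.inr ⟨rfl, rfl⟩)
  have g0 := hp 0
  have g1 := hp 1
  have g2 := hp 2
  have close3 : ∀ (P : ℕ × ℕ → Prop) (a b c d e f a' b' c' : ℕ × ℕ), P a → P b → P c → P d → P e →
      P f → P a' → P b' → P c' → ∀ z ∈ [a, b, c, d, e, f, a', b', c'], P z := by
    intro P a b c d e f a' b' c' _ _ _ _ _ _ _ _ _ z hz
    simp only [List.mem_cons, List.not_mem_nil, or_false] at hz
    rcases hz with rfl | rfl | rfl | rfl | rfl | rfl | rfl | rfl | rfl <;> assumption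
  fin_cases k <;> fin_cases i <;> fin_cases j <;>
    first
    | exact absurd rfl hij
    | exact absurd rfl hki
    | exact absurd rfl hkj
    | exact main 3 rfl (Or.inl (close3 _ _ _ _ _ _ _ _ _ _ g0 g1 g2 huv huk hvk huj hvi hpij.symm))
    | exact main 3 rfl (Or.inr (close3 _ _ _ _ _ _ _ _ _ _ g0 g1 g2 huv.symm hvk huk hvi huj hpij))
    | exact main 4 rfl (Or.inl (close3 _ _ _ _ _ _ _ _ _ _ g0 g1 g2 huv huk hvk huj hvi hpij))
    | exact main 4 rfl (Or.inr (close3 _ _ _ _ _ _ _ _ _ _ g0 g1 g2 huv.symm hvk huk hvi huj hpij.symm))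
    | exact main 5 rfl (Or.inl (close3 _ _ _ _ _ _ _ _ _ _ g0 g1 g2 huv huk hvk huj hvi hpij.symm))
    | exact main 5 rfl (Or.inr (close3 _ _ _ _ _ _ _ _ _ _ g0 g1 g2 huv.symm hvk huk hvi huj hpij))

theorem Net2.classify {N : LabGraph (Fin 3)} (h : Net2 N)
    (ht : TEC N.G (Finset.univ.filter (fun v => v ∉ Set.range N.leaf))) : Base N := by
  set W := Finset.univ.filter (fun v => v ∉ Set.range N.leaf) with hWdef
  have hmW : ∀ v, v ∈ W ↔ v ∉ Set.range N.leaf := by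
    intro v
    rw [hWdef, Finset.mem_filter]
    simp
  clear_value W
  choose p hp hpu using h.leaf_nbr
  have hcW : Wᶜ = Finset.univ.image N.leaf := by
    ext v
    simp only [Finset.mem_compl, hmW, not_not, Finset.mem_image, Finset.mem_univ, true_and, Set.mem_range]
  have hcc : Wᶜ.card = 3 := by
    rw [hcW, Finset.card_image_of_injective _ h.inj]
    rfl
  have hcard : Fintype.card N.V = W.card + 3 := by
    have := Finset.card_add_card_compl W
    omega
  have hlW : ∀ i, N.leaf i ∈ Wᶜ := by
    intro i
    rw [hcW]
    exact Finset.mem_image_of_mem _ (Finset.mem_univ _)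
  have hpW : ∀ i, p i ∈ W := by
    intro i
    rw [hmW]
    rintro ⟨j, hj⟩
    obtain ⟨k, hki, hkj⟩ := third i j
    have hij := hp i
    rw [← hj] at hij
    obtain ⟨a, ha, b, hb, hab⟩ := conn_cut h.conn {N.leaf i, N.leaf j} ⟨_, Or.inl rfl⟩ (by
      intro e
      have : N.leaf k ∈ ({N.leaf i, N.leaf j} : Set N.V) := e ▸ Set.mem_univ _
      rcases this with e | e
      · exact hki (h.inj e)
      · exact hkj (h.inj e))
    rcases ha with rfl | rfl
    · exact hb (Or.inr (h.leaf_uniq i hab hij))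
    · exact hb (Or.inl (h.leaf_uniq j hab hij.symm))
  have hd3 : ∀ v ∈ W, dg N.G W v + dg N.G Wᶜ v = 3 := by
    intro v hv
    rw [dg_split, h.deg3 v ((hmW v).1 hv)]
  have hsur : ∀ w, (∃ i, w = N.leaf i) ∨ w ∈ W := by
    intro w
    by_cases hw : w ∈ W
    · exact Or.inr hw
    · rw [hmW, not_not] at hw
      obtain ⟨i, rfl⟩ := hw
      exact Or.inl ⟨i, rfl⟩
  have hout : ∑ v ∈ W, dg N.G Wᶜ v ≤ 3 := by
    rw [dg_dc]
    calc ∑ w ∈ Wᶜ, dg N.G W w ≤ ∑ w ∈ Wᶜ, 1 := by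
          apply Finset.sum_le_sum
          intro w hw
          rw [hcW] at hw
          obtain ⟨i, _, rfl⟩ := Finset.mem_image.1 hw
          rw [← h.deg1 i]
          exact dg_mono _ (Finset.subset_univ _) _
      _ = 3 := by rw [Finset.sum_const, hcc]; rfl
  have hle5 : W.card ≤ 5 := by
    by_contra hh
    have := h.count W (fun v hv => (hmW v).1 hv) ht (by omega)
    omega
  have hpos : 1 ≤ W.card := Finset.card_pos.2 ⟨p 0, hpW 0⟩
  by_cases h1 : W.card = 1
  · -- tripod
    obtain ⟨w, hw⟩ := Finset.card_eq_one.1 h1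
    have hpw : ∀ i, p i = w := by
      intro i
      have := hpW i
      rw [hw] at this
      simpa using this
    have hadj : ∀ i, N.G.Adj (N.leaf i) w := fun i => hpw i ▸ hp i
    refine ⟨0, iso_dat h 0 (fun m => [N.leaf 0, N.leaf 1, N.leaf 2, w].getD m w) ?_ ?_ ?_ ?_⟩
    · rw [hcard, h1]; rfl
    · intro i
      fin_cases i <;> rfl
    · intro v
      show ∃ m < 4, _
      rcases hsur v with ⟨i, rfl⟩ | hv
      · refine ⟨i.1, by omega, ?_⟩
        fin_cases i <;> rfl
      · rw [hw, Finset.mem_singleton] at hv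
        exact ⟨3, by omega, hv.symm⟩
    · intro e he
      change e ∈ [(0, 3), (1, 3), (2, 3)] at he
      simp only [List.mem_cons, List.not_mem_nil, or_false] at he
      rcases he with rfl | rfl | rfl
      · exact hadj 0
      · exact hadj 1
      · exact hadj 2
  have hdg2 : ∀ v ∈ W, 2 ≤ dg N.G W v := by
    intro v hv
    obtain ⟨a, ha, b, hb, a', ha', b', hb', hbA, hbA', hab, hab', hne⟩ := ht {v}
      (Finset.singleton_subset_iff.2 hv) (Finset.singleton_nonempty v) (by
        intro e
        apply h1
        rw [← e]
        exact Finset.card_singleton v)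
    rw [Finset.mem_singleton] at ha ha'
    subst ha
    subst ha'
    exact dg_two _ hb hab hb' hab' (fun e => hne ⟨rfl, e⟩)
  have hpinj : Function.Injective p := by
    intro i j hij
    by_contra hne
    have e1 := hd3 _ (hpW i)
    have e2 := hdg2 _ (hpW i)
    have e3 := dg_two N.G (hlW i) (hp i).symm (hlW j) (hij ▸ (hp j).symm) (fun e => hne (h.inj e))
    omega
  have hdp : ∀ i, dg N.G W (p i) = 2 := by
    intro i
    have e1 := hd3 _ (hpW i)
    have e2 := hdg2 _ (hpW i)
    have e3 := dg_pos N.G (hlW i) (hp i).symm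
    omega
  have hdo : ∀ v ∈ W, (∀ i, v ≠ p i) → dg N.G W v = 3 := by
    intro v hv hvp
    have e1 := hd3 _ hv
    have e2 : dg N.G Wᶜ v = 0 := by
      apply Finset.card_eq_zero.2
      rw [Finset.filter_eq_empty_iff]
      intro w hw hadj
      rw [hcW] at hw
      obtain ⟨i, _, rfl⟩ := Finset.mem_image.1 hw
      exact hvp i (hpu i v hadj.symm)
    omega
  have hpsub : Finset.univ.image p ⊆ W := by
    intro w hw
    obtain ⟨i, _, rfl⟩ := Finset.mem_image.1 hw
    exact hpW i
  have hpcard : (Finset.univ.image p).card = 3 := by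
    rw [Finset.card_image_of_injective _ hpinj]
    rfl
  have hge3 := Finset.card_le_card hpsub
  rw [hpcard] at hge3
  have hcases : W.card = 3 ∨ W.card = 4 ∨ W.card = 5 := by omega
  rcases hcases with hc | hc | hc
  · -- triangle
    have hWp := Finset.eq_of_subset_of_card_le hpsub (by omega)
    have hadj : ∀ i j, i ≠ j → N.G.Adj (p i) (p j) := by
      intro i j hij
      exact dg_full N.G (hpW i) (by rw [hdp i]; omega) _ (hpW j) (fun e => hij (hpinj e).symm)
    refine ⟨1, iso_dat h 1 (fun m => [N.leaf 0, N.leaf 1, N.leaf 2, p 0, p 1, p 2].getD m (p 0))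
      ?_ ?_ ?_ ?_⟩
    · rw [hcard, hc]; rfl
    · intro i
      fin_cases i <;> rfl
    · intro v
      show ∃ m < 6, _
      rcases hsur v with ⟨i, rfl⟩ | hv
      · refine ⟨i.1, by omega, ?_⟩
        fin_cases i <;> rfl
      · rw [← hWp] at hv
        obtain ⟨i, _, rfl⟩ := Finset.mem_image.1 hv
        refine ⟨i.1 + 3, by omega, ?_⟩
        fin_cases i <;> rfl
    · intro e he
      change e ∈ [(0, 3), (1, 4), (2, 5), (3, 4), (4, 5), (3, 5)] at he
      simp only [List.mem_cons, List.not_mem_nil, or_false] at he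
      rcases he with rfl | rfl | rfl | rfl | rfl | rfl
      · exact hp 0
      · exact hp 1
      · exact hp 2
      · exact hadj 0 1 (by decide)
      · exact hadj 1 2 (by decide)
      · exact hadj 0 2 (by decide)
  · -- parity
    exfalso
    have e1 := N.G.sum_degrees_eq_twice_card_edges
    have e2 : ∑ v, N.G.degree v = ∑ v, dg N.G Finset.univ v := by
      apply Finset.sum_congr rfl
      intro v _
      unfold dg
      rw [← SimpleGraph.card_neighborFinset_eq_degree]
      congr 1
      ext w
      simp
    have e3 : ∑ v, dg N.G Finset.univ v = 15 := by
      rw [← Finset.sum_add_sum_compl W]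
      have a1 : ∑ v ∈ W, dg N.G Finset.univ v = ∑ v ∈ W, 3 :=
        Finset.sum_congr rfl (fun v hv => h.deg3 v ((hmW v).1 hv))
      have a2 : ∑ v ∈ Wᶜ, dg N.G Finset.univ v = ∑ v ∈ Wᶜ, 1 := by
        apply Finset.sum_congr rfl
        intro v hv
        rw [hcW] at hv
        obtain ⟨i, _, rfl⟩ := Finset.mem_image.1 hv
        exact h.deg1 i
      rw [a1, a2, Finset.sum_const, Finset.sum_const, hc, hcc]
      rfl
    omega
  · -- five inner vertices
    obtain ⟨u, v, huv, hUV⟩ : ∃ u v, u ≠ v ∧ W \ Finset.univ.image p = {u, v} := by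
      rw [← Finset.card_eq_two, Finset.card_sdiff_of_subset hpsub, hpcard, hc]
    have hu : u ∈ W \ Finset.univ.image p := by rw [hUV]; simp
    have hv : v ∈ W \ Finset.univ.image p := by rw [hUV]; simp
    rw [Finset.mem_sdiff] at hu hv
    obtain ⟨huW, hu⟩ := hu
    obtain ⟨hvW, hv⟩ := hv
    have hup : ∀ i, u ≠ p i := fun i e => hu (e ▸ Finset.mem_image_of_mem p (Finset.mem_univ i))
    have hvp : ∀ i, v ≠ p i := fun i e => hv (e ▸ Finset.mem_image_of_mem p (Finset.mem_univ i))
    have hWs : ∀ w ∈ W, (∃ i, w = p i) ∨ w = u ∨ w = v := by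
      intro w hw
      by_cases hwp : w ∈ Finset.univ.image p
      · obtain ⟨i, _, rfl⟩ := Finset.mem_image.1 hwp
        exact Or.inl ⟨i, rfl⟩
      · have : w ∈ W \ Finset.univ.image p := Finset.mem_sdiff.2 ⟨hw, hwp⟩
        rw [hUV] at this
        simp only [Finset.mem_insert, Finset.mem_singleton] at this
        exact Or.inr this
    have hsur' : ∀ w, (∃ i, w = N.leaf i) ∨ (∃ i, w = p i) ∨ w = u ∨ w = v := by
      intro w
      rcases hsur w with hw | hw
      · exact Or.inl hw
      · exact Or.inr (hWs w hw)
    have hcard8 : Fintype.card N.V = 8 := by rw [hcard, hc]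
    have hdu := hdo u huW hup
    have hdv := hdo v hvW hvp
    have mu : ∀ a ∈ W, ∀ b ∈ W, a ≠ u → b ≠ u → ¬ N.G.Adj u a → ¬ N.G.Adj u b → a = b :=
      fun a ha b hb => dg_miss hc (le_of_eq hdu.symm) huW ha hb
    have mv : ∀ a ∈ W, ∀ b ∈ W, a ≠ v → b ≠ v → ¬ N.G.Adj v a → ¬ N.G.Adj v b → a = b :=
      fun a ha b hb => dg_miss hc (le_of_eq hdv.symm) hvW ha hb
    by_cases hadj : N.G.Adj u v
    · have exi : ∀ w w', w ∈ W → w' ∈ W → (∀ i, w' ≠ p i) → N.G.Adj w w' → dg N.G W w = 3 →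
          ∃ i, ¬ N.G.Adj w (p i) := by
        intro w w' hw hw' hwp ha hd
        by_contra hcon
        push Not at hcon
        have : ({w', p 0, p 1, p 2} : Finset N.V) ⊆ W.filter (fun z => N.G.Adj w z) := by
          intro z hz
          simp only [Finset.mem_insert, Finset.mem_singleton] at hz
          rw [Finset.mem_filter]
          rcases hz with rfl | rfl | rfl | rfl
          · exact ⟨hw', ha⟩
          · exact ⟨hpW 0, hcon 0⟩
          · exact ⟨hpW 1, hcon 1⟩
          · exact ⟨hpW 2, hcon 2⟩
        have h4 := Finset.card_le_card this
        have e01 : p 0 ≠ p 1 := fun e => absurd (hpinj e) (by decide)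
        have e02 : p 0 ≠ p 2 := fun e => absurd (hpinj e) (by decide)
        have e12 : p 1 ≠ p 2 := fun e => absurd (hpinj e) (by decide)
        rw [Finset.card_insert_of_notMem (by simp [hwp 0, hwp 1, hwp 2]),
          Finset.card_eq_three.2 ⟨p 0, p 1, p 2, e01, e02, e12, rfl⟩] at h4
        unfold dg at hd
        omega
      obtain ⟨i, hi⟩ := exi u v huW hvW hvp hadj hdu
      obtain ⟨j, hj⟩ := exi v u hvW huW hup hadj.symm hdv
      have hua : ∀ m, m ≠ i → N.G.Adj u (p m) := by
        intro m hm
        by_contra hh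
        exact hm (hpinj (mu _ (hpW m) _ (hpW i) (hup m).symm (hup i).symm hh hi))
      have hva : ∀ m, m ≠ j → N.G.Adj v (p m) := by
        intro m hm
        by_contra hh
        exact hm (hpinj (mv _ (hpW m) _ (hpW j) (hvp m).symm (hvp j).symm hh hj))
      by_cases hij : i = j
      · exfalso
        subst hij
        obtain ⟨a, b, hai, hbi, hab, hall⟩ := others i
        obtain ⟨h5, h6⟩ := two_of (a := p a) (b := p b) (hdg2 _ (hpW i)) (by
          intro z hz hzi
          rcases hWs z hz with ⟨m, rfl⟩ | rfl | rfl
          · rcases hall m with rfl | rfl | rfl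
            · exact absurd hzi (N.G.irrefl)
            · exact Or.inl rfl
            · exact Or.inr rfl
          · exact absurd hzi.symm hi
          · exact absurd hzi.symm hj)
        have := dg_three (hpW i) huW hvW h5.symm (hua a hai).symm (hva a hai).symm
          (hup i).symm (hvp i).symm huv
        have := hdp a
        omega
      · obtain ⟨k, hki, hkj, hall⟩ := third' i j hij
        obtain ⟨h5, h6⟩ := two_of (a := v) (b := p j) (hdg2 _ (hpW i)) (by
          intro z hz hzi
          rcases hWs z hz with ⟨m, rfl⟩ | rfl | rfl
          · rcases hall m with rfl | rfl | rfl
            · exact absurd hzi (N.G.irrefl)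
            · exact Or.inr rfl
            · exfalso
              have := dg_three (hpW i) huW hvW hzi.symm (hua m hki).symm (hva m hkj).symm
                (hup i).symm (hvp i).symm huv
              have := hdp m
              omega
          · exact absurd hzi.symm hi
          · exact Or.inl rfl)
        exact theta_ex h p u v hcard8 hp hsur' hadj i j k hij hki hkj (hua j (Ne.symm hij)) (hua k hki)
          (hva i hij) (hva k hkj) h6
    · -- K23
      have hua : ∀ m, N.G.Adj u (p m) := by
        intro m
        by_contra hh
        exact hvp m (mu _ hvW _ (hpW m) huv.symm (hup m).symm hadj hh)
      have hva : ∀ m, N.G.Adj v (p m) := by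
        intro m
        by_contra hh
        exact hup m (mv _ huW _ (hpW m) huv (hvp m).symm (fun e => hadj e.symm) hh)
      refine ⟨2, iso_dat h 2 (fun m => [N.leaf 0, N.leaf 1, N.leaf 2, p 0, p 1, p 2, u, v].getD m u)
        ?_ ?_ ?_ ?_⟩
      · rw [hcard8]; rfl
      · intro i
        fin_cases i <;> rfl
      · intro w
        show ∃ m < 8, _
        rcases hsur' w with ⟨i, rfl⟩ | ⟨i, rfl⟩ | rfl | rfl
        · refine ⟨i.1, by omega, ?_⟩
          fin_cases i <;> rfl
        · refine ⟨i.1 + 3, by omega, ?_⟩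
          fin_cases i <;> rfl
        · exact ⟨6, by omega, rfl⟩
        · exact ⟨7, by omega, rfl⟩
      · intro e he
        change e ∈ [(0, 3), (1, 4), (2, 5), (6, 3), (6, 4), (6, 5), (7, 3), (7, 4), (7, 5)] at he
        simp only [List.mem_cons, List.not_mem_nil, or_false] at he
        rcases he with rfl | rfl | rfl | rfl | rfl | rfl | rfl | rfl | rfl
        · exact hp 0
        · exact hp 1
        · exact hp 2
        · exact hua 0
        · exact hua 1
        · exact hua 2
        · exact hva 0
        · exact hva 1
        · exact hva 2

theorem peel_step {X : Type} {N N' : LabGraph X} (h : Net2 N) (h' : Net2 N') {x : X}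
    (hd : Dia N x) (hd' : Dia N' x)
    (hdist : ∀ y z, y ≠ z → N.G.dist (N.leaf y) (N.leaf z) = N'.G.dist (N'.leaf y) (N'.leaf z))
    (ih : ∀ M M' : LabGraph X, Fintype.card M.V < Fintype.card N.V → Net2 M → Net2 M' →
      (∀ y z, y ≠ z → M.G.dist (M.leaf y) (M.leaf z) = M'.G.dist (M'.leaf y) (M'.leaf z)) →
      Iso M M') : Iso N N' := by
  obtain ⟨M, hM, hi, hc⟩ := h.peel hd
  obtain ⟨M', hM', hi', _⟩ := h'.peel hd'
  refine hi.trans ((Dx_iso x (ih M M' hc hM hM' ?_)).trans hi'.symm)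
  have key : ∀ y, y ≠ x → M.G.dist (M.leaf y) (M.leaf x) = M'.G.dist (M'.leaf y) (M'.leaf x) := by
    intro y hy
    have e1 := hi.dist h.conn y x
    have e2 := hi'.dist h'.conn y x
    rw [Dx_dist_new hM.conn x y hy] at e1
    rw [Dx_dist_new hM'.conn x y hy] at e2
    have := hdist y x hy
    omega
  intro y z hyz
  by_cases hy : y = x
  · subst hy
    rw [SimpleGraph.dist_comm, key z (Ne.symm hyz), SimpleGraph.dist_comm]
  by_cases hz : z = x
  · subst hz
    exact key y hy
  have e1 := hi.dist h.conn y z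
  have e2 := hi'.dist h'.conn y z
  rw [Dx_dist_old hM.conn x y z hy hz] at e1
  rw [Dx_dist_old hM'.conn x y z hy hz] at e2
  have := hdist y z hyz
  omega

theorem Base.dists {N : LabGraph (Fin 3)} (h : Net2 N) {k : Fin 6} (hb : Iso N (mdl k)) :
    N.G.dist (N.leaf 0) (N.leaf 1) = (dtab k).1 ∧
    N.G.dist (N.leaf 0) (N.leaf 2) = (dtab k).2.1 ∧
    N.G.dist (N.leaf 1) (N.leaf 2) = (dtab k).2.2 := by
  rw [hb.dist h.conn 0 1, hb.dist h.conn 0 2, hb.dist h.conn 1 2]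
  exact mdl_dist k

theorem Base.bd {N : LabGraph (Fin 3)} (h : Net2 N) (hb : Base N) (x y : Fin 3) (hxy : x ≠ y) :
    2 ≤ N.G.dist (N.leaf x) (N.leaf y) ∧ N.G.dist (N.leaf x) (N.leaf y) ≤ 4 := by
  obtain ⟨k, hk⟩ := hb
  obtain ⟨e1, e2, e3⟩ := Base.dists h hk
  have hbd := dtab_bd k
  have f1 := N.G.dist_comm (u := N.leaf 1) (v := N.leaf 0)
  have f2 := N.G.dist_comm (u := N.leaf 2) (v := N.leaf 0)
  have f3 := N.G.dist_comm (u := N.leaf 2) (v := N.leaf 1)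
  have main : ∀ a b : Fin 3, a ≠ b → (a = 0 ∧ b = 1) ∨ (a = 0 ∧ b = 2) ∨ (a = 1 ∧ b = 2) ∨
      (a = 1 ∧ b = 0) ∨ (a = 2 ∧ b = 0) ∨ (a = 2 ∧ b = 1) := by decide
  rcases main x y hxy with ⟨rfl, rfl⟩ | ⟨rfl, rfl⟩ | ⟨rfl, rfl⟩ | ⟨rfl, rfl⟩ | ⟨rfl, rfl⟩ | ⟨rfl, rfl⟩ <;>
    omega

theorem struct_aux : ∀ (n : ℕ) (N : LabGraph (Fin 3)), Fintype.card N.V = n → Net2 N →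
    ∃ (c : Fin 3 → Fin 3 → ℕ) (k : Fin 3 → ℕ),
      (∀ x y, x ≠ y → c x y ≤ 2 ∧
        N.G.dist (N.leaf x) (N.leaf y) = c x y + 2 + 3 * (k x + k y)) ∧
      (∀ x, 0 < k x → Dia N x) ∧ ((∀ x, k x = 0) → Base N) := by
  intro n
  induction n using Nat.strong_induction_on with
  | _ n ih =>
  intro N hn h
  rcases h.central (by simp) with ⟨x, hx⟩ | ht
  · obtain ⟨M, hM, hi, hc⟩ := h.peel hx
    obtain ⟨c, k, h1, h2, _⟩ := ih _ (hn ▸ hc) M rfl hM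
    have key : ∀ y, y ≠ x → N.G.dist (N.leaf y) (N.leaf x) = M.G.dist (M.leaf y) (M.leaf x) + 3 := by
      intro y hy
      rw [hi.dist h.conn y x, Dx_dist_new hM.conn x y hy]
    refine ⟨c, fun y => if y = x then k y + 1 else k y, ?_, ?_, ?_⟩
    · intro y z hyz
      refine ⟨(h1 y z hyz).1, ?_⟩
      have e := (h1 y z hyz).2
      by_cases hy : y = x
      · subst hy
        have hz : z ≠ y := Ne.symm hyz
        rw [SimpleGraph.dist_comm, key z hz, SimpleGraph.dist_comm, e]
        simp only [if_true, if_neg hz]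
        omega
      · by_cases hz : z = x
        · subst hz
          rw [key y hy, e]
          simp only [if_true, if_neg hy]
          omega
        · rw [hi.dist h.conn y z, Dx_dist_old hM.conn x y z hy hz, e]
          simp only [if_neg hy, if_neg hz]
    · intro y hy
      by_cases hyx : y = x
      · rw [hyx]; exact hx
      · simp only [if_neg hyx] at hy
        exact Dia.iso hi.symm ((h2 y hy).Dx hyx)
    · intro h0
      have := h0 x
      simp at this
  · have hb := h.classify ht
    refine ⟨fun x y => N.G.dist (N.leaf x) (N.leaf y) - 2, fun _ => 0, ?_, ?_, fun _ => hb⟩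
    · intro x y hxy
      have := Base.bd h hb x y hxy
      constructor <;> simp only [] <;> omega
    · intro x hx
      exact absurd hx (lt_irrefl _)

theorem three_aux : ∀ (n : ℕ) (N N' : LabGraph (Fin 3)), Fintype.card N.V = n → Net2 N → Net2 N' →
    (∀ y z, y ≠ z → N.G.dist (N.leaf y) (N.leaf z) = N'.G.dist (N'.leaf y) (N'.leaf z)) →
    Iso N N' := by
  intro n
  induction n using Nat.strong_induction_on with
  | _ n ih =>
  intro N N' hn h h' hdist
  obtain ⟨c, k, h1, h2, h3⟩ := struct_aux _ N rfl h
  obtain ⟨c', k', h1', h2', h3'⟩ := struct_aux _ N' rfl h'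
  have hk2 : ∀ x y, x ≠ y → k x + k y = k' x + k' y := by
    intro x y hxy
    have a1 := h1 x y hxy
    have a2 := h1' x y hxy
    have a3 := hdist x y hxy
    omega
  have hkk : ∀ x, k x = k' x := by
    intro x
    obtain ⟨a, b, ha, hb, hab, _⟩ := others x
    have a1 := hk2 x a ha.symm
    have a2 := hk2 x b hb.symm
    have a3 := hk2 a b hab
    omega
  by_cases h0 : ∀ x, k x = 0
  · obtain ⟨q, hq⟩ := h3 h0
    obtain ⟨q', hq'⟩ := h3' (fun x => by rw [← hkk]; exact h0 x)
    obtain ⟨e1, e2, e3⟩ := Base.dists h hq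
    obtain ⟨e1', e2', e3'⟩ := Base.dists h' hq'
    have hqq : q = q' := by
      apply dtab_inj
      refine Prod.ext ?_ (Prod.ext ?_ ?_)
      · rw [← e1, ← e1']; exact hdist 0 1 (by decide)
      · rw [← e2, ← e2']; exact hdist 0 2 (by decide)
      · rw [← e3, ← e3']; exact hdist 1 2 (by decide)
    subst hqq
    exact hq.trans hq'.symm
  · push Not at h0
    obtain ⟨x, hx⟩ := h0
    have hx1 : 0 < k x := Nat.pos_of_ne_zero hx
    exact peel_step h h' (h2 x hx1) (h2' x (hkk x ▸ hx1)) hdist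
      (fun M M' hc hM hM' hd => ih _ (hn ▸ hc) M M' rfl hM hM' hd)

/-- Relabelling. -/
def rl {X Y : Type} (e : Y → X) (N : LabGraph X) : LabGraph Y := ⟨N.V, N.G, fun y => N.leaf (e y)⟩

theorem rl_net {X Y : Type} (e : Y ≃ X) {N : LabGraph X} (h : Net2 N) : Net2 (rl e N) where
  conn := h.conn
  inj := fun _ _ hab => e.injective (h.inj hab)
  deg1 := fun y => h.deg1 (e y)
  deg3 := fun v hv => h.deg3 v (by
    rintro ⟨x, hx⟩
    refine hv ⟨e.symm x, ?_⟩
    show N.leaf (e (e.symm x)) = v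
    rw [e.apply_symm_apply, hx])
  lev := h.lev

theorem rl_iso {X Y : Type} (e : Y ≃ X) {N N' : LabGraph X} (h : Iso (rl e N) (rl e N')) :
    Iso N N' := by
  obtain ⟨φ, hφ⟩ := h
  refine ⟨φ, fun x => ?_⟩
  have := hφ (e.symm x)
  change φ (N.leaf (e (e.symm x))) = N'.leaf (e (e.symm x)) at this
  rwa [e.apply_symm_apply] at this

theorem net2_zero {X : Type} [Fintype X] (hX : Fintype.card X = 0) {N : LabGraph X} (h : Net2 N) :
    False := by
  have hE : IsEmpty X := Fintype.card_eq_zero_iff.1 hX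
  rcases h.central (by omega) with ⟨x, _⟩ | ht
  · exact hE.elim x
  set W := Finset.univ.filter (fun v => v ∉ Set.range N.leaf) with hW
  have hWu : W = Finset.univ := by
    rw [hW, Finset.filter_eq_self]
    rintro v _ ⟨x, _⟩
    exact hE.elim x
  have hnl : ∀ v ∈ W, v ∉ Set.range N.leaf := by
    rintro v _ ⟨x, _⟩
    exact hE.elim x
  have hs : ∑ v ∈ W, dg N.G Wᶜ v = 0 := by
    rw [dg_dc, hWu]
    simp
  obtain ⟨v⟩ := h.conn.nonempty
  have hpos : 1 ≤ W.card := Finset.card_pos.2 ⟨v, by rw [hWu]; simp⟩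
  have h2 : W.card ≤ 2 := by
    by_contra hh
    have := h.count W hnl ht (by omega)
    omega
  have h3 := h.out_lb W hnl
  rw [hs] at h3
  have : W.card = 1 ∨ W.card = 2 := by omega
  rcases this with e | e <;> rw [e] at h3 <;> omega

theorem net2_erase {X : Type} {N : LabGraph X} (h : Net2 N) (x : X) :
    ∃ p, Pend N.G (Finset.univ.erase (N.leaf x)) p (N.leaf x) := by
  obtain ⟨p, hp, hu⟩ := h.leaf_nbr x
  refine ⟨p, Finset.mem_erase.2 ⟨hp.ne', Finset.mem_univ _⟩, by simp, hp.symm, ?_⟩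
  intro c _ d hd hcd
  have : d = N.leaf x := by
    by_contra hne
    exact hd (Finset.mem_erase.2 ⟨hne, Finset.mem_univ _⟩)
  subst this
  exact ⟨hu c hcd.symm, rfl⟩

theorem net2_one {X : Type} [Fintype X] (hX : Fintype.card X = 1) {N : LabGraph X} (h : Net2 N) :
    False := by
  obtain ⟨x, hx⟩ := Fintype.card_eq_one_iff.1 hX
  obtain ⟨p, hp⟩ := net2_erase h x
  obtain ⟨y, hy, _⟩ := h.pendant _ _ _ hp ((Finset.card_filter_le _ _).trans (by
    rw [Finset.card_univ, hX]))
  rw [hx y] at hy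
  simp at hy

theorem net2_two {X : Type} [Fintype X] {x y : X} (hxy : x ≠ y) (hall : ∀ z, z = x ∨ z = y)
    {N : LabGraph X} (h : Net2 N) : Dia N y ∨ ∀ v, v = N.leaf x ∨ v = N.leaf y := by
  obtain ⟨p, hp⟩ := net2_erase h x
  obtain ⟨z, hz, h2⟩ := h.pendant _ _ _ hp (by
    rw [← Finset.card_singleton y]
    apply Finset.card_le_card
    intro z hz
    rw [Finset.mem_filter] at hz
    rcases hall z with rfl | rfl
    · simp at hz
    · simp)
  rcases hall z with rfl | rfl
  · simp at hz
  · rcases h2 with h2 | h2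
    · right
      intro v
      by_cases hv : v = N.leaf x
      · exact Or.inl hv
      · have : v ∈ Finset.univ.erase (N.leaf x) := Finset.mem_erase.2 ⟨hv, Finset.mem_univ _⟩
        rw [h2] at this
        exact Or.inr (by simpa using this)
    · exact Or.inl h2

theorem edge_adj {X : Type} {x y : X} {N : LabGraph X} (h : Net2 N)
    (hv : ∀ v, v = N.leaf x ∨ v = N.leaf y) : N.G.Adj (N.leaf x) (N.leaf y) := by
  obtain ⟨p, hp, _⟩ := h.leaf_nbr x
  rcases hv p with rfl | rfl
  · exact absurd hp N.G.irrefl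
  · exact hp

theorem dia_not_edge {X : Type} {x y : X} {N N' : LabGraph X} (h : Net2 N) (h' : Net2 N')
    (hv : ∀ v, v = N.leaf x ∨ v = N.leaf y) (hd : Dia N' y)
    (hdist : N.G.dist (N.leaf x) (N.leaf y) = N'.G.dist (N'.leaf x) (N'.leaf y)) : False := by
  rw [SimpleGraph.dist_eq_one_iff_adj.2 (edge_adj h hv)] at hdist
  have hadj := SimpleGraph.dist_eq_one_iff_adj.1 hdist.symm
  obtain ⟨p, c, d, u, h1, h2, h3, h4, _⟩ := hd
  have := h'.leaf_uniq y h1 hadj.symm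
  subst this
  exact h4.ne (h'.leaf_uniq x h2 h3)

theorem edge_iso {X : Type} {x y : X} (hxy : x ≠ y) (hall : ∀ z, z = x ∨ z = y) {N N' : LabGraph X}
    (h : Net2 N) (h' : Net2 N') (hv : ∀ v, v = N.leaf x ∨ v = N.leaf y)
    (hv' : ∀ v, v = N'.leaf x ∨ v = N'.leaf y) : Iso N N' := by
  have bij : ∀ K : LabGraph X, Net2 K → (∀ v, v = K.leaf x ∨ v = K.leaf y) →
      Function.Bijective K.leaf := by
    intro K hK hvK
    refine ⟨hK.inj, fun v => ?_⟩
    rcases hvK v with rfl | rfl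
    · exact ⟨x, rfl⟩
    · exact ⟨y, rfl⟩
  have ad : ∀ K : LabGraph X, Net2 K → (∀ v, v = K.leaf x ∨ v = K.leaf y) →
      ∀ a b, K.G.Adj (K.leaf a) (K.leaf b) ↔ a ≠ b := by
    intro K hK hvK a b
    refine ⟨fun hab e => hab.ne (by rw [e]), fun hab => ?_⟩
    have := edge_adj hK hvK
    rcases hall a with rfl | rfl <;> rcases hall b with rfl | rfl
    · exact absurd rfl hab
    · exact this
    · exact this.symm
    · exact absurd rfl hab
  let e := Equiv.ofBijective _ (bij N h hv)
  let e' := Equiv.ofBijective _ (bij N' h' hv')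
  refine ⟨⟨e.symm.trans e', ?_⟩, ?_⟩
  · intro a b
    obtain ⟨a, rfl⟩ := e.surjective a
    obtain ⟨b, rfl⟩ := e.surjective b
    simp only [Equiv.trans_apply, Equiv.symm_apply_apply]
    exact (ad N' h' hv' a b).trans (ad N h hv a b).symm
  · intro z
    show e' (e.symm (e z)) = N'.leaf z
    rw [Equiv.symm_apply_apply]
    rfl

theorem two_aux {X : Type} [Fintype X] {x y : X} (hxy : x ≠ y) (hall : ∀ z, z = x ∨ z = y) :
    ∀ (n : ℕ) (N N' : LabGraph X), Fintype.card N.V = n → Net2 N → Net2 N' →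
    (∀ y z, y ≠ z → N.G.dist (N.leaf y) (N.leaf z) = N'.G.dist (N'.leaf y) (N'.leaf z)) →
    Iso N N' := by
  intro n
  induction n using Nat.strong_induction_on with
  | _ n ih =>
  intro N N' hn h h' hdist
  rcases net2_two hxy hall h with hd | hd <;> rcases net2_two hxy hall h' with hd' | hd'
  · exact peel_step h h' hd hd' hdist
      (fun M M' hc hM hM' hdd => ih _ (hn ▸ hc) M M' rfl hM hM' hdd)
  · exact (dia_not_edge h' h hd' hd (hdist x y hxy).symm).elim
  · exact (dia_not_edge h h' hd hd' (hdist x y hxy)).elim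
  · exact edge_iso hxy hall h h' hd hd'

theorem single_iso {X : Type} {N N' : LabGraph X} (h : Fintype.card N.V = 1)
    (h' : Fintype.card N'.V = 1) : Iso N N' := by
  obtain ⟨v, hv⟩ := Fintype.card_eq_one_iff.1 h
  obtain ⟨w, hw⟩ := Fintype.card_eq_one_iff.1 h'
  refine ⟨⟨⟨fun _ => w, fun _ => v, fun a => (hv a).symm, fun a => (hw a).symm⟩, ?_⟩, fun x => (hw _).symm⟩
  intro a b
  rw [hv a, hv b]
  exact ⟨fun hh => absurd hh N'.G.irrefl, fun hh => absurd hh N.G.irrefl⟩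

end Aux

/-- Lemma: Level-2 networks on at most 3 leaves are reconstructible from their
shortest distances. -/
theorem level2_atMost3_reconstructible_from_shortest_distances
    (X : Type) [Fintype X] [DecidableEq X] (hX : Fintype.card X ≤ 3)
    (N N' : LabGraph X) (hN : N.IsNetwork) (hN' : N'.IsNetwork)
    (hlev : N.IsLevel 2) (hlev' : N'.IsLevel 2)
    (hd : ∀ x y : X, N.dm x y = N'.dm x y) :
    N.IsomLabelled N' := by
  have hdd : ∀ y z, y ≠ z → N.G.dist (N.leaf y) (N.leaf z) = N'.G.dist (N'.leaf y) (N'.leaf z) :=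
    fun y z _ => hd y z
  have main : N.Iso N' := by
    rcases net2_of N hN hlev with ⟨hc, h1⟩ | h
    · rcases net2_of N' hN' hlev' with ⟨_, h1'⟩ | h'
      · exact single_iso h1 h1'
      · exact (net2_one hc h').elim
    rcases net2_of N' hN' hlev' with ⟨hc, _⟩ | h'
    · exact (net2_one hc h).elim
    have hcases : Fintype.card X = 0 ∨ Fintype.card X = 1 ∨ Fintype.card X = 2 ∨
        Fintype.card X = 3 := by omega
    rcases hcases with hc | hc | hc | hc
    · exact (net2_zero hc h).elim
    · exact (net2_one hc h).elim
    · obtain ⟨x, y, hxy, hu⟩ := Finset.card_eq_two.1 (Finset.card_univ.trans hc)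
      refine two_aux hxy (fun z => ?_) _ N N' rfl h h' hdd
      have : z ∈ (Finset.univ : Finset X) := Finset.mem_univ z
      rw [hu] at this
      simpa using this
    · let e : Fin 3 ≃ X := (Fintype.equivFinOfCardEq hc).symm
      exact rl_iso e (three_aux _ (rl e N) (rl e N') rfl (rl_net e h) (rl_net e h')
        (fun y z hyz => hdd _ _ (fun hh => hyz (e.injective hh))))
  exact main

end LabGraph
end

section
/- Let N be a level-2 phylogenetic network on X in which leaves x and y form a cherry, and let N' be the graph obtained from N by removing x and y together with their incident edges and labelling their common neighbour by a new leaf z. Then N' is a level-2 network on X' = (X \ {x, y}) ∪ {z}, and its multisets of distances satisfy d^{N'}(a,b) = d^{N}(a,b) for all a, b ∈ X \ {x, y} and d^{N'}(a,z) = d^{N}(a,x) − 1 for all a ∈ X \ {x, y}. -/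
open SimpleGraph

namespace LabGraph

variable {X : Type} [Fintype X] [DecidableEq X]

/-- Reduce the cherry `{x, y}` with common neighbour `p`: remove the two leaves `x, y`
(and their incident edges) and label `p` by a new leaf (the `Unit` summand). -/
noncomputable def cherryReduce (N : LabGraph X) (x y : X) (p : N.V)
    (hpx : p ≠ N.leaf x) (hpy : p ≠ N.leaf y)
    (hinj : ∀ a : X, a ≠ x → a ≠ y → N.leaf a ≠ N.leaf x ∧ N.leaf a ≠ N.leaf y) :
    LabGraph ({a : X // a ≠ x ∧ a ≠ y} ⊕ Unit) where
  V := {v : N.V // v ≠ N.leaf x ∧ v ≠ N.leaf y}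
  fV := by classical exact inferInstance
  G := SimpleGraph.comap Subtype.val N.G
  leaf := Sum.elim
    (fun a => ⟨N.leaf a.1, (hinj a.1 a.2.1 a.2.2).1, (hinj a.1 a.2.1 a.2.2).2⟩)
    (fun _ => ⟨p, hpx, hpy⟩)

section CherryHelpers

variable {V W : Type} {G : SimpleGraph V} {G' : SimpleGraph W}

/-- A vertex with at most one neighbour lies on a path only as an endpoint. -/
lemma pendant_path_end {z p : V} (hz : ∀ w, G.Adj z w → w = p) {u v : V} (P : G.Walk u v) :
    P.IsPath → z ∈ P.support → z = u ∨ z = v := by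
  induction P with
  | nil => intro _ h; left; simpa using h
  | @cons a b c h Q ih =>
    intro hP hmem
    rw [Walk.cons_isPath_iff] at hP
    rw [Walk.support_cons, List.mem_cons] at hmem
    rcases hmem with h1 | h1
    · exact Or.inl h1
    rcases ih hP.1 h1 with h2 | h2
    · subst h2
      cases Q with
      | nil => exact Or.inr rfl
      | @cons _ b' _ h' R =>
        exfalso
        have e1 := hz _ h'
        have e2 := hz _ h.symm
        apply hP.2
        rw [e2, ← e1]
        simp
    · exact Or.inr h2

/-- Paths to a vertex `z` of degree one correspond to paths to its neighbour. -/
lemma pendant_ext {z p u : V} (hz : ∀ w, G.Adj z w → w = p) (hx : G.Adj z p) (hu : z ≠ u) :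
    ∃ φ : G.Path u p → G.Path u z, Function.Bijective φ ∧
      ∀ P, (φ P).1.length = P.1.length + 1 := by
  have hext : ∀ P : G.Path u p, (Walk.cons hx P.1.reverse).reverse.IsPath := by
    intro P
    rw [Walk.isPath_reverse_iff, Walk.cons_isPath_iff, Walk.isPath_reverse_iff]
    refine ⟨P.2, ?_⟩
    rw [Walk.support_reverse, List.mem_reverse]
    intro hmem
    rcases pendant_path_end hz _ P.2 hmem with h | h
    · exact hu h
    · exact hx.ne h
  refine ⟨fun P => ⟨_, hext P⟩, ⟨?_, ?_⟩, ?_⟩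
  · intro P Q h
    have h1 := Walk.reverse_injective (congrArg Subtype.val h)
    injection h1 with _ _ _ h1
    exact Subtype.ext (Walk.reverse_injective h1)
  · rintro ⟨P, hP⟩
    obtain ⟨R, rfl⟩ : ∃ R : G.Walk z u, R.reverse = P :=
      ⟨P.reverse, Walk.reverse_reverse _⟩
    have hR := (Walk.isPath_reverse_iff _).1 hP
    cases R with
    | nil => exact absurd rfl hu
    | @cons _ b _ h R =>
      have := hz _ h
      subst this
      rw [Walk.cons_isPath_iff] at hR
      refine ⟨⟨R.reverse, (Walk.isPath_reverse_iff _).2 hR.1⟩, Subtype.ext ?_⟩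
      simp only [Walk.reverse_reverse]
  · intro P
    simp

/-- A walk through the range of an embedding lifts along the embedding. -/
lemma walk_lift (f : G' ↪g G) {u v : V} (P : G.Walk u v) :
    ∀ (a b : W) (ha : f a = u) (hb : f b = v), (∀ w ∈ P.support, w ∈ Set.range f) →
      ∃ Q : G'.Walk a b, (Q.map f.toHom).copy ha hb = P := by
  induction P with
  | nil =>
    intro a b ha hb _
    subst ha
    have := f.injective hb
    subst this
    exact ⟨Walk.nil, rfl⟩
  | @cons u t v h Q ih =>
    intro a b ha hb hs
    obtain ⟨c, rfl⟩ := hs t (by simp)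
    subst ha
    subst hb
    obtain ⟨R, hR⟩ := ih c b rfl rfl (fun w hw => hs w (by simp [hw]))
    refine ⟨Walk.cons (f.map_adj_iff.1 h) R, ?_⟩
    subst hR
    rfl

/-- The isomorphism between a subgraph and its image under an embedding. -/
lemma map_coe_connected_iff (f : G' ↪g G) (H : G'.Subgraph) :
    (H.map f.toHom).coe.Connected ↔ H.coe.Connected := by
  let e : H.verts ≃ (H.map f.toHom).verts := Equiv.Set.image f H.verts f.injective
  let i : H.coe ≃g (H.map f.toHom).coe :=
    { e with
      map_rel_iff' := by
        rintro ⟨a, ha⟩ ⟨b, hb⟩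
        change Relation.Map H.Adj f f (f a) (f b) ↔ H.Adj a b
        constructor
        · rintro ⟨a', b', h, h1, h2⟩
          rw [← f.injective h1, ← f.injective h2]
          exact h
        · intro h
          exact ⟨a, b, h, rfl, rfl⟩ }
  exact i.connected_iff.symm

lemma map_deleteVerts (f : G' ↪g G) (H : G'.Subgraph) (v : W) :
    (H.map f.toHom).deleteVerts {f v} = (H.deleteVerts {v}).map f.toHom := by
  ext a b
  · simp only [Subgraph.deleteVerts_verts, Subgraph.map_verts]
    constructor
    · rintro ⟨⟨c, hc, rfl⟩, h⟩
      exact ⟨c, ⟨hc, fun h' => h (by rw [Set.mem_singleton_iff.1 h']; rfl)⟩, rfl⟩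
    · rintro ⟨c, ⟨hc, h⟩, rfl⟩
      exact ⟨⟨c, hc, rfl⟩, fun h' => h (f.injective h')⟩
  · rw [Subgraph.deleteVerts_adj]
    constructor
    · rintro ⟨_, h1, _, h2, ⟨c, d, hcd, rfl, rfl⟩⟩
      refine ⟨c, d, ?_, rfl, rfl⟩
      rw [Subgraph.deleteVerts_adj]
      exact ⟨H.edge_vert hcd, fun h' => h1 (by rw [Set.mem_singleton_iff.1 h']; rfl),
        H.edge_vert hcd.symm, fun h' => h2 (by rw [Set.mem_singleton_iff.1 h']; rfl), hcd⟩
    · rintro ⟨c, d, hcd, rfl, rfl⟩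
      rw [Subgraph.deleteVerts_adj] at hcd
      obtain ⟨h1, h2, h3, h4, h5⟩ := hcd
      exact ⟨⟨c, h1, rfl⟩, fun h' => h2 (f.injective h'), ⟨d, h3, rfl⟩,
        fun h' => h4 (f.injective h'), ⟨c, d, h5, rfl, rfl⟩⟩

lemma map_comap_eq (f : G' ↪g G) (H : G.Subgraph) (hH : H.verts ⊆ Set.range f) :
    (H.comap f.toHom).map f.toHom = H := by
  ext a b
  · constructor
    · rintro ⟨c, hc, rfl⟩
      exact hc
    · intro h
      obtain ⟨c, rfl⟩ := hH h
      exact ⟨c, h, rfl⟩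
  · constructor
    · rintro ⟨c, d, h, rfl, rfl⟩
      exact h.2
    · intro h
      obtain ⟨c, rfl⟩ := hH (H.edge_vert h)
      obtain ⟨d, rfl⟩ := hH (H.edge_vert h.symm)
      exact ⟨c, d, ⟨f.map_adj_iff.1 (H.adj_sub h), h⟩, rfl, rfl⟩

lemma twoConnSub_map_iff {Y Z : Type} (N : LabGraph Y) (M : LabGraph Z) (f : M.G ↪g N.G)
    (H : M.G.Subgraph) : N.TwoConnSub (H.map f.toHom) ↔ M.TwoConnSub H := by
  unfold TwoConnSub
  rw [map_coe_connected_iff, Subgraph.map_verts, Set.ncard_image_of_injective H.verts (f := f.toHom) f.injective]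
  refine and_congr Iff.rfl (and_congr Iff.rfl ?_)
  constructor
  · intro h v hv
    have := h (f v) ⟨v, hv, rfl⟩
    rwa [map_deleteVerts, map_coe_connected_iff] at this
  · rintro h _ ⟨v, hv, rfl⟩
    have := h v hv
    rw [← map_coe_connected_iff f, ← map_deleteVerts] at this
    exact this

/-- A 2-connected subgraph contains no vertex with at most one neighbour. -/
lemma pendant_notMem_twoConn {Y : Type} (N : LabGraph Y) (H : N.G.Subgraph)
    (hH : N.TwoConnSub H) {z p : N.V} (hz : ∀ w, N.G.Adj z w → w = p) (hzp : z ≠ p) :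
    z ∉ H.verts := by
  intro hzH
  obtain ⟨h3, hc, hd⟩ := hH
  -- `p` lies in `H`
  have key : ∀ (K : N.G.Subgraph), K.coe.Connected → z ∈ K.verts → ∀ t ∈ K.verts, t ≠ z →
      p ∈ K.verts := by
    intro K hK hzK t ht htz
    obtain ⟨P⟩ := hK.preconnected ⟨z, hzK⟩ ⟨t, ht⟩
    cases P with
    | nil => exact absurd rfl htz
    | @cons _ b _ h _ =>
      have h' : K.Adj z b.1 := h
      rw [← hz _ (K.adj_sub h')]
      exact b.2
  obtain ⟨t, ht, ht'⟩ : ∃ t ∈ H.verts, t ∉ ({z, p} : Set N.V) := by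
    refine Set.exists_mem_notMem_of_ncard_lt_ncard ?_ (Set.toFinite _)
    rw [Set.ncard_pair hzp]
    omega
  simp only [Set.mem_insert_iff, Set.mem_singleton_iff, not_or] at ht'
  have hp := key H hc hzH t ht ht'.1
  have := key _ (hd p hp) ⟨hzH, hzp⟩ t ⟨ht, ht'.2⟩ ht'.1
  exact this.2 rfl

end CherryHelpers

/-- Observation 1 (cherry reduction): if leaves `x` and `y` of a level-2 network `N`
form a cherry with common neighbour `p`, then removing `x` and `y` and labelling `p`
by a new leaf `z` yields a level-2 network `N'` on `X' = (X \ {x,y}) ∪ {z}` with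
`d^{N'}(a,b) = d^N(a,b)` for `a, b ∈ X \ {x,y}` and `d^{N'}(a,z) = d^N(a,x) - 1`. -/
theorem cherry_reduction
    (X : Type) [Fintype X] [DecidableEq X]
    (N : LabGraph X) (hN : N.IsNetwork) (hlev : N.IsLevel 2)
    (x y : X) (hxy : x ≠ y) (p : N.V)
    (hx : N.G.Adj (N.leaf x) p) (hy : N.G.Adj (N.leaf y) p) :
    ∀ N' : LabGraph ({a : X // a ≠ x ∧ a ≠ y} ⊕ Unit),
      N' = N.cherryReduce x y p hx.ne' hy.ne'
          (fun a hax hay => ⟨fun h => hax (hN.2.1 h), fun h => hay (hN.2.1 h)⟩) →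
      (N'.IsNetwork ∧ N'.IsLevel 2 ∧
        (∀ (a b : X) (ha : a ≠ x ∧ a ≠ y) (hb : b ≠ x ∧ b ≠ y),
          N'.dms (Sum.inl ⟨a, ha⟩) (Sum.inl ⟨b, hb⟩) = N.dms a b) ∧
        (∀ (a : X) (ha : a ≠ x ∧ a ≠ y),
          toZ (N'.dms (Sum.inl ⟨a, ha⟩) (Sum.inr ())) = zsub (N.dms a x) 1)) := by
  classical
  rintro N' rfl
  obtain ⟨hconn, hinj, hdeg⟩ := hN
  have hdeg : (∀ x : X, N.degOf (N.leaf x) = 1) ∧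
        ∀ v : N.V, v ∉ Set.range N.leaf → N.degOf v = 3 := by
    rcases hdeg with h | h
    · exfalso
      have := Fintype.one_lt_card_iff.2 ⟨x, y, hxy⟩
      omega
    · exact h
  obtain ⟨hd1, hd3⟩ := hdeg
  have hleaf : ∀ a q, N.G.Adj (N.leaf a) q → ∀ w, N.G.Adj (N.leaf a) w → w = q := by
    intro a q hq w hw
    obtain ⟨c, hc⟩ := Set.ncard_eq_one.1 (hd1 a)
    have h1 : q ∈ N.G.neighborSet (N.leaf a) := hq
    have h2 : w ∈ N.G.neighborSet (N.leaf a) := hw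
    rw [hc] at h1 h2
    rw [Set.mem_singleton_iff.1 h1, Set.mem_singleton_iff.1 h2]
  have hlxy : N.leaf x ≠ N.leaf y := fun h => hxy (hinj h)
  have hpn : p ∉ Set.range N.leaf := by
    rintro ⟨a, rfl⟩
    exact hlxy (hleaf a _ hy.symm _ hx.symm)
  have hzx := hleaf x p hx
  have hzy := hleaf y p hy
  set N' := N.cherryReduce x y p hx.ne' hy.ne'
    (fun a hax hay => ⟨fun h => hax (hinj h), fun h => hay (hinj h)⟩) with hN'
  let f : N'.G ↪g N.G := ⟨⟨Subtype.val, Subtype.val_injective⟩, Iff.rfl⟩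
  have hrange : ∀ v, v ∈ Set.range f ↔ (v ≠ N.leaf x ∧ v ≠ N.leaf y) := by
    intro v
    constructor
    · rintro ⟨w, rfl⟩
      exact w.2
    · intro h
      exact ⟨⟨v, h⟩, rfl⟩
  -- lifting paths
  have lift : ∀ (a b : N'.V) (P : N.G.Walk (f a) (f b)), P.IsPath →
      ∃ Q : N'.G.Walk a b, Q.map f.toHom = P := by
    intro a b P hP
    obtain ⟨Q, hQ⟩ := walk_lift f P a b rfl rfl (by
      intro w hw
      rw [hrange]
      constructor
      · rintro rfl
        rcases pendant_path_end hzx P hP hw with h | h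
        · exact a.2.1 h.symm
        · exact b.2.1 h.symm
      · rintro rfl
        rcases pendant_path_end hzy P hP hw with h | h
        · exact a.2.2 h.symm
        · exact b.2.2 h.symm)
    exact ⟨Q, hQ⟩
  have hfinj : Function.Injective f.toHom := f.injective
  have himg : ∀ v : N'.V, f '' (N'.G.neighborSet v) =
      N.G.neighborSet (f v) \ {N.leaf x, N.leaf y} := by
    intro v
    ext w
    constructor
    · rintro ⟨u, hu, rfl⟩
      refine ⟨hu, ?_⟩
      rintro (h | h)
      · exact u.2.1 h
      · exact u.2.2 h
    · rintro ⟨h1, h2⟩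
      simp only [Set.mem_insert_iff, Set.mem_singleton_iff, not_or] at h2
      exact ⟨⟨w, h2⟩, h1, rfl⟩
  have hdegp : ∀ v : N'.V, f v = p → N'.degOf v = 1 := by
    intro v hv
    unfold degOf
    rw [← Set.ncard_image_of_injective _ f.injective, himg, hv, Set.ncard_sdiff, Set.ncard_pair hlxy]
    · have := hd3 p hpn
      unfold degOf at this
      omega
    · rintro w (rfl | rfl)
      · exact hx.symm
      · exact hy.symm
  have hdegn : ∀ v : N'.V, f v ≠ p → N'.degOf v = N.degOf (f v) := by
    intro v hv
    unfold degOf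
    rw [← Set.ncard_image_of_injective _ f.injective, himg]
    congr 1
    rw [sdiff_eq_left, Set.disjoint_right]
    rintro w (rfl | rfl) h
    · exact hv (hzx _ h.symm)
    · exact hv (hzy _ h.symm)
  have hmapeq : ∀ {α β γ : Type} [Fintype α] [Fintype β] (e : α → β) (_ : Function.Bijective e)
      (g : α → γ) (k : β → γ) (_ : ∀ a, g a = k (e a)),
      (Finset.univ : Finset α).val.map g = (Finset.univ : Finset β).val.map k := by
    intro α β γ _ _ e he g k hg
    rw [← Multiset.map_univ_val_equiv (Equiv.ofBijective e he), Multiset.map_map]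
    exact Multiset.map_congr rfl (fun a _ => hg a)
  have hbij : ∀ a b : N'.V, Function.Bijective
      (fun P : N'.G.Path a b => (P.map f.toHom hfinj : N.G.Path (f a) (f b))) := by
    intro a b
    refine ⟨Path.map_injective hfinj _ _, ?_⟩
    intro P
    obtain ⟨Q, hQ⟩ := lift a b P.1 P.2
    refine ⟨⟨Q, ?_⟩, Subtype.ext hQ⟩
    apply Walk.IsPath.of_map (f := f.toHom)
    rw [hQ]
    exact P.2
  refine ⟨⟨?_, ?_, Or.inr ⟨?_, ?_⟩⟩, ?_, ?_, ?_⟩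
  · have : Nonempty N'.V := ⟨⟨p, hx.ne', hy.ne'⟩⟩
    refine ⟨fun a b => ?_⟩
    obtain ⟨P, hP⟩ := (hconn.preconnected (f a) (f b)).exists_isPath
    obtain ⟨Q, _⟩ := lift a b P hP
    exact ⟨Q⟩
  · rintro (a | a) (b | b) h
    · have : N.leaf a.1 = N.leaf b.1 := congrArg f h
      rw [Subtype.ext (hinj this)]
    · exact absurd ⟨a.1, congrArg f h⟩ hpn
    · exact absurd ⟨b.1, (congrArg f h).symm⟩ hpn
    · rfl
  · rintro (a | a)
    · rw [hdegn]
      · exact hd1 a.1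
      · intro h
        exact hpn ⟨a.1, h⟩
    · exact hdegp _ rfl
  · intro v hv
    have hvp : f v ≠ p := by
      intro h
      exact hv ⟨Sum.inr (), Subtype.ext h.symm⟩
    rw [hdegn v hvp]
    apply hd3
    rintro ⟨a, ha⟩
    have hax : a ≠ x := by
      rintro rfl
      exact v.2.1 ha.symm
    have hay : a ≠ y := by
      rintro rfl
      exact v.2.2 ha.symm
    exact hv ⟨Sum.inl ⟨a, hax, hay⟩, Subtype.ext ha⟩
  · intro H hH
    have hb : N.IsBlob (H.map f.toHom) := by
      refine ⟨(twoConnSub_map_iff N N' f H).2 hH.1, ?_⟩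
      intro H' hH' hle
      have hr : H'.verts ⊆ Set.range f := by
        intro v hv
        rw [hrange]
        constructor
        · rintro rfl
          exact pendant_notMem_twoConn N H' hH' hzx hx.ne hv
        · rintro rfl
          exact pendant_notMem_twoConn N H' hH' hzy hy.ne hv
      have he := map_comap_eq f H' hr
      have h1 : N'.TwoConnSub (H'.comap f.toHom) := by
        rw [← twoConnSub_map_iff N N' f, he]
        exact hH'
      have h2 := hH.2 _ h1 ((Subgraph.map_le_iff_le_comap _ _ _).1 hle)
      rw [← he, h2]
    have := hlev _ hb
    rw [Subgraph.edgeSet_map, Subgraph.map_verts, Set.ncard_image_of_injective _ hfinj,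
      Set.ncard_image_of_injective _ (Sym2.map.injective hfinj)] at this
    exact this
  · intro a b ha hb
    unfold dms
    refine hmapeq _ (hbij (N'.leaf (Sum.inl ⟨a, ha⟩)) (N'.leaf (Sum.inl ⟨b, hb⟩))) _ _ ?_
    intro P
    exact (Walk.length_map _ _).symm
  · intro a ha
    unfold dms toZ zsub
    simp only [Multiset.bind_def, Multiset.pure_def, Multiset.bind_singleton, Multiset.map_map]
    obtain ⟨φ, hφ, hl⟩ := pendant_ext (u := N.leaf a) hzx hx (fun h => ha.1 (hinj h.symm))
    refine hmapeq _
      (hφ.comp (hbij (N'.leaf (Sum.inl ⟨a, ha⟩)) (N'.leaf (Sum.inr ())))) _ _ ?_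
    intro P
    have h1 := hl (P.map f.toHom hfinj)
    have h2 : (P.map f.toHom hfinj).1.length = P.1.length := Walk.length_map _ _
    have h3 := h1.trans (congrArg (· + 1) h2)
    have h4 : (((φ (P.map f.toHom hfinj)).1.length : ℕ) : ℤ) = (P.1.length : ℤ) + 1 := by
      exact_mod_cast h3
    exact (sub_eq_iff_eq_add.2 h4).symm

end LabGraph
end
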